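/- arXiv:1106.0867 — 3 statements merged into one kernel-verified Lean document; each statement's English description precedes it below -/
import Mathlib

section
/- Let Δ be the tetrahedral group [3,5,3]⁺, let p be an odd prime with p ≡ ±2 (mod 5), and let s ∈ F_{p²} satisfy s² = 5. If 3+2s and 3−2s are both non-squares in F_{p²}, then Δ has exactly one normal subgroup K with Δ/K isomorphic to PSL(2, F_{p⁴}). -/
/-- The relators of the tetrahedral group `Δ = [3,5,3]⁺`, on generators
`α = of 0`, `β = of 1`, `γ = of 2`. -/
def tetRelators : Set (FreeGroup (Fin 3)) :=
  { FreeGroup.of 0 ^ 3, FreeGroup.of 1 ^ 5, FreeGroup.of 2 ^ 3,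
    (FreeGroup.of 0 * FreeGroup.of 1) ^ 2, (FreeGroup.of 1 * FreeGroup.of 2) ^ 2,
    (FreeGroup.of 0 * FreeGroup.of 1 * FreeGroup.of 2) ^ 2 }

/-- The tetrahedral group `Δ = [3,5,3]⁺` as a presented group. -/
abbrev Tet : Type := PresentedGroup tetRelators

/-- `K` is a normal subgroup of `Δ` with `Δ/K ≅ PSL(2, F)`. -/
def IsPSLQuotient (F : Type) [Field F] (K : Subgroup Tet) : Prop :=
  ∃ f : Tet →* Matrix.ProjectiveSpecialLinearGroup (Fin 2) F,
    Function.Surjective f ∧ f.ker = K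

open scoped MatrixGroups LinearAlgebra.Projectivization
open MulAction

theorem dickson_arith {m n f n₁ : ℤ} (hm : 7 ≤ m) (hodd : m % 2 = 1) (hn : 1 ≤ n)
    (hnm : n ≤ m - 1) (hf : m + 1 ≤ f) (hn₁ : 1 ≤ n₁)
    (h : m * n * f = n₁ * (2 + (m - 2) * f)) :
    f = m + 1 ∧ ((n = m - 1 ∧ n₁ = m + 1) ∨ (2 * n = m - 1 ∧ 2 * n₁ = m + 1)) := by
  obtain ⟨c, hc⟩ : ∃ c, c = n * m - n₁ * (m - 2) := ⟨_, rfl⟩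
  obtain ⟨j, hj⟩ : ∃ j, j = n₁ - n := ⟨_, rfl⟩
  have hfc : f * c = 2 * n₁ := by rw [hc]; linear_combination h
  have hcj : c * (f - 1) = m * j := by rw [hj]; linear_combination hfc - hc
  have h2n : c + j * (m - 2) = 2 * n := by rw [hc, hj]; ring
  have hc1 : 1 ≤ c := by
    by_contra! hlt
    nlinarith
  have hcj' : c ≤ j := by
    have : c * m ≤ m * j := by nlinarith
    nlinarith
  have hj2 : j ≤ 2 := by
    by_contra! hlt
    nlinarith
  have hcases : (j = 1 ∧ c = 1) ∨ (j = 2 ∧ c = 1) ∨ (j = 2 ∧ c = 2) := by omega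
  rcases hcases with ⟨rfl, rfl⟩ | ⟨rfl, rfl⟩ | ⟨rfl, rfl⟩ <;> omega

theorem orbit_count_coprime {Ω : Type*} [Fintype Ω] [DecidableEq Ω] (n f : Ω → ℕ) (N : ℕ)
    (hn : ∀ ω, 1 ≤ n ω) (hf : ∀ ω, 3 ≤ f ω) (hN : ∀ ω, n ω * f ω = N)
    (hsum : ∑ ω, (1 - (n ω : ℚ)⁻¹) = 2 - 2 / N) (ω₀ : Ω) : n ω₀ ≤ 5 := by
  by_contra! h6
  have hnpos : ∀ ω, (0 : ℚ) < n ω := fun ω => by exact_mod_cast hn ω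
  obtain ⟨i, hi⟩ : ∃ i : Ω → ℚ, i = fun ω => (n ω : ℚ)⁻¹ := ⟨_, rfl⟩
  obtain ⟨c, hc⟩ : ∃ c : Ω → ℚ, c = fun ω => 1 - i ω := ⟨_, rfl⟩
  have hci : ∀ ω, c ω = 1 - i ω := fun ω => by rw [hc]
  have hin : ∀ ω, i ω = (n ω : ℚ)⁻¹ := fun ω => by rw [hi]
  have hinv : ∀ (ω : Ω) (k : ℕ), 0 < k → k ≤ n ω → i ω ≤ (k : ℚ)⁻¹ := fun ω k hk h => by
    rw [hin]
    exact inv_anti₀ (by exact_mod_cast hk) (by exact_mod_cast h)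
  have h2 : ∀ ω, 2 ≤ n ω → i ω ≤ 1 / 2 := fun ω h => by
    simpa using hinv ω 2 two_pos h
  have h3 : ∀ ω, 3 ≤ n ω → i ω ≤ 1 / 3 := fun ω h => by
    simpa using hinv ω 3 (by norm_num) h
  have hipos : ∀ ω, 0 < i ω := fun ω => by rw [hin]; exact inv_pos.2 (hnpos ω)
  have hc0 : ∀ ω, 0 ≤ c ω := fun ω => by
    have := hinv ω 1 one_pos (hn ω); rw [hci]; norm_num at this; linarith
  have hchalf : ∀ ω, 0 < c ω → 2 ≤ n ω := fun ω h => by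
    by_contra! hlt
    have h1 : n ω = 1 := by have := hn ω; omega
    rw [hci, hin, h1] at h
    norm_num at h
  have hNpos : (0 : ℚ) < N := by
    rw [← hN ω₀]; push_cast
    have := hnpos ω₀; have : (0 : ℚ) < f ω₀ := by exact_mod_cast (by have := hf ω₀; omega)
    positivity
  have hbig : 3 / (N : ℚ) ≤ i ω₀ := by
    rw [hin, ← one_div, div_le_div_iff₀ hNpos (hnpos ω₀), ← hN ω₀]; push_cast
    have : (3 : ℚ) ≤ f ω₀ := by exact_mod_cast hf ω₀
    nlinarith [hnpos ω₀]
  have hNi : 0 < 1 / (N : ℚ) := by positivity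
  have e2 : 2 / (N : ℚ) = 2 * (1 / N) := by ring
  have e3 : 3 / (N : ℚ) = 3 * (1 / N) := by ring
  rw [e3] at hbig
  have hω₀ : i ω₀ ≤ 1 / 6 := by simpa using hinv ω₀ 6 (by norm_num) h6
  have s0 : c ω₀ + ∑ ω ∈ Finset.univ.erase ω₀, c ω = 2 - 2 * (1 / N) := by
    rw [Finset.add_sum_erase _ _ (Finset.mem_univ _), ← e2, ← hsum]
    simp only [hci, hin]
  have hci₀ := hci ω₀
  obtain ⟨ω₁, m1, p1⟩ : ∃ ω ∈ Finset.univ.erase ω₀, 0 < c ω := by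
    by_contra! hcon
    have := Finset.sum_nonpos hcon
    linarith
  have s1 := Finset.add_sum_erase _ c m1
  have hci₁ := hci ω₁
  have hip := hipos ω₁
  obtain ⟨ω₂, m2, p2⟩ : ∃ ω ∈ (Finset.univ.erase ω₀).erase ω₁, 0 < c ω := by
    by_contra! hcon
    have := Finset.sum_nonpos hcon
    linarith
  have s2 := Finset.add_sum_erase _ c m2
  have hci₂ := hci ω₂
  have hrest : 0 ≤ ∑ ω ∈ ((Finset.univ.erase ω₀).erase ω₁).erase ω₂, c ω :=
    Finset.sum_nonneg fun ω _ => hc0 ω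
  have a1 := h2 ω₁ (hchalf _ p1)
  have a2 := h2 ω₂ (hchalf _ p2)
  have hz : ∑ ω ∈ ((Finset.univ.erase ω₀).erase ω₁).erase ω₂, c ω = 0 := by
    refine Finset.sum_eq_zero fun ω hω => ?_
    by_contra hne
    have a3 := h2 ω (hchalf _ (lt_of_le_of_ne (hc0 ω) (Ne.symm hne)))
    have := Finset.single_le_sum (f := c) (fun ω _ => hc0 ω) hω
    have := hci ω
    linarith
  rcases Nat.lt_or_ge (n ω₁) 3 with h1 | h1
  · rcases Nat.lt_or_ge (n ω₂) 3 with h4 | h4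
    · have b1 : n ω₁ = 2 := by have := hchalf _ p1; omega
      have b2 : n ω₂ = 2 := by have := hchalf _ p2; omega
      have d1 : i ω₁ = 1 / 2 := by rw [hin, b1]; norm_num
      have d2 : i ω₂ = 1 / 2 := by rw [hin, b2]; norm_num
      linarith
    · have := h3 _ h4
      linarith
  · have := h3 _ h1
    linarith

theorem orbit_count_modular {Ω : Type*} [Fintype Ω] [DecidableEq Ω] (m n f : Ω → ℕ) (N : ℕ)
    (hm : ∀ ω, m ω = 1 ∨ (7 ≤ m ω ∧ m ω % 2 = 1 ∧ n ω ≤ m ω - 1 ∧ m ω + 1 ≤ f ω))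
    (hn : ∀ ω, 1 ≤ n ω) (hN : ∀ ω, m ω * n ω * f ω = N)
    (hsum : ∑ ω, (1 + 1 / (n ω : ℚ) - 2 / (m ω * n ω)) = 2 - 2 / N) (ω₀ : Ω)
    (h₀ : m ω₀ ≠ 1) :
    f ω₀ = m ω₀ + 1 ∧ m ω₀ - 1 ∣ 2 * n ω₀ ∧
      ∀ ω, 2 * n ω ∣ 2 * (m ω₀ - 1) ∨ 2 * n ω ∣ 2 * (m ω₀ + 1) := by
  set c : Ω → ℚ := fun ω => 1 + 1 / (n ω : ℚ) - 2 / (m ω * n ω) with hc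
  obtain ⟨h7, hodd, hnm, hfm⟩ := (hm ω₀).resolve_left h₀
  have hnpos : ∀ ω, (0 : ℚ) < n ω := fun ω => by exact_mod_cast hn ω
  have hinv : ∀ (ω : Ω) (k : ℕ), 0 < k → k ≤ n ω → 1 / (n ω : ℚ) ≤ 1 / k := fun ω k hk h =>
    one_div_le_one_div_of_le (by exact_mod_cast hk) (by exact_mod_cast h)
  have hipos : ∀ ω, 0 < 1 / (n ω : ℚ) := fun ω => by have := hnpos ω; positivity
  have hcm1 : ∀ ω, m ω = 1 → c ω = 1 - 1 / (n ω : ℚ) := fun ω h => by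
    simp only [hc, h]; push_cast; ring
  have hcm7 : ∀ ω, 7 ≤ m ω → 1 + (5 / 7) * (1 / (n ω : ℚ)) ≤ c ω := fun ω h => by
    have h7' : (7 : ℚ) ≤ m ω := by exact_mod_cast h
    have e : 2 / ((m ω : ℚ) * n ω) = 2 * (1 / (m ω : ℚ)) * (1 / n ω) := by
      have := hnpos ω; field_simp
    have : 1 / (m ω : ℚ) ≤ 1 / 7 := one_div_le_one_div_of_le (by norm_num) h7'
    simp only [hc, e]
    nlinarith [hipos ω]
  have hc0 : ∀ ω, 0 ≤ c ω := fun ω => by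
    rcases hm ω with h | h
    · rw [hcm1 ω h]; have := hinv ω 1 one_pos (hn ω); norm_num at this ⊢; exact this
    · have := hcm7 ω h.1; have := hipos ω; linarith
  have hNpos : (0 : ℚ) < N := by
    rw [← hN ω₀]
    have : 0 < f ω₀ := by omega
    have := hn ω₀
    have : 0 < m ω₀ := by omega
    positivity
  have hNi : 0 < 2 / (N : ℚ) := by positivity
  have s0 : c ω₀ + ∑ ω ∈ Finset.univ.erase ω₀, c ω = 2 - 2 / N := by
    rw [Finset.add_sum_erase _ _ (Finset.mem_univ _)]; exact hsum
  have hc₀ := hcm7 ω₀ h7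
  have hmo : ∀ ω, ω ≠ ω₀ → m ω = 1 := fun ω hω => by
    by_contra h
    have := Finset.single_le_sum (f := c) (fun ω _ => hc0 ω)
      (Finset.mem_erase.2 ⟨hω, Finset.mem_univ ω⟩)
    have := hcm7 ω ((hm ω).resolve_left h).1
    have := hipos ω
    have := hipos ω₀
    linarith
  have hhalf : ∀ ω, ω ≠ ω₀ → n ω ≠ 1 → 1 / 2 ≤ c ω := fun ω hω h => by
    have := hinv ω 2 two_pos (by have := hn ω; omega)
    rw [hcm1 ω (hmo ω hω)]; norm_num at this ⊢; linarith
  have key : m ω₀ * n ω₀ * f ω₀ = N := hN ω₀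
  have keyQ : (m ω₀ : ℚ) * n ω₀ * f ω₀ = N := by exact_mod_cast key
  have h7Q : (7 : ℚ) ≤ m ω₀ := by exact_mod_cast h7
  have hfQ : (m ω₀ : ℚ) + 1 ≤ f ω₀ := by exact_mod_cast hfm
  have hc₀e : c ω₀ = 1 + 1 / (n ω₀ : ℚ) - 2 / (m ω₀ * n ω₀) := rfl
  obtain ⟨ω₁, hω₁, hn₁⟩ : ∃ ω, ω ≠ ω₀ ∧ n ω ≠ 1 := by
    by_contra! hcon
    have hz : ∑ ω ∈ Finset.univ.erase ω₀, c ω = 0 := by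
      refine Finset.sum_eq_zero fun ω hω => ?_
      have hω' := (Finset.mem_erase.1 hω).1
      rw [hcm1 ω (hmo ω hω'), hcon ω hω']; norm_num
    rw [hz, hc₀e, ← keyQ] at s0
    have := hnpos ω₀
    have h8 : (8 : ℚ) ≤ f ω₀ := by linarith
    have hf0 : (f ω₀ : ℚ) ≠ 0 := by linarith
    have hm0 : (m ω₀ : ℚ) ≠ 0 := by linarith
    field_simp at s0
    have hn1 : (1 : ℚ) ≤ n ω₀ := by exact_mod_cast hn ω₀
    have : (m ω₀ : ℚ) * f ω₀ ≤ m ω₀ * n ω₀ * f ω₀ := by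
      have : (0 : ℚ) < m ω₀ * f ω₀ := by positivity
      nlinarith
    nlinarith
  have m1 : ω₁ ∈ Finset.univ.erase ω₀ := Finset.mem_erase.2 ⟨hω₁, Finset.mem_univ _⟩
  have s1 := Finset.add_sum_erase _ c m1
  have hrest : ∀ ω, ω ≠ ω₀ → ω ≠ ω₁ → n ω = 1 := fun ω h0 h1 => by
    by_contra h
    have := Finset.single_le_sum (f := c) (fun ω _ => hc0 ω)
      (Finset.mem_erase.2 ⟨h1, Finset.mem_erase.2 ⟨h0, Finset.mem_univ ω⟩⟩)
    have := hhalf ω h0 h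
    have := hhalf ω₁ hω₁ hn₁
    have := hipos ω₀
    linarith
  have hz : ∑ ω ∈ (Finset.univ.erase ω₀).erase ω₁, c ω = 0 := by
    refine Finset.sum_eq_zero fun ω hω => ?_
    simp only [Finset.mem_erase, Finset.mem_univ, and_true] at hω
    rw [hcm1 ω (hmo ω hω.2), hrest ω hω.2 hω.1]; norm_num
  rw [hz, hcm1 ω₁ (hmo ω₁ hω₁)] at s1
  rw [← s1, hc₀e, ← keyQ] at s0
  have eqQ : (m ω₀ : ℚ) * n ω₀ * f ω₀ = n ω₁ * (2 + (m ω₀ - 2) * f ω₀) := by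
    have := hnpos ω₀
    have := hnpos ω₁
    have hf0 : (f ω₀ : ℚ) ≠ 0 := by linarith
    have hm0 : (m ω₀ : ℚ) ≠ 0 := by linarith
    field_simp at s0
    linarith
  have eqZ : (m ω₀ : ℤ) * n ω₀ * f ω₀ = n ω₁ * (2 + (m ω₀ - 2) * f ω₀) := by exact_mod_cast eqQ
  have hn0 := hn ω₀
  have hn1 := hn ω₁
  obtain ⟨hf, hor⟩ := dickson_arith (by omega) (by omega) (by omega) (by omega) (by omega)
    (by omega) eqZ
  refine ⟨by omega, ?_, fun ω => ?_⟩
  · rcases hor with h | h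
    · exact ⟨2, by omega⟩
    · exact ⟨1, by omega⟩
  · by_cases h0 : ω = ω₀
    · subst h0
      left
      rcases hor with h | h
      · exact ⟨1, by omega⟩
      · exact ⟨2, by omega⟩
    · right
      by_cases h1 : ω = ω₁
      · subst h1
        rcases hor with h | h
        · exact ⟨1, by omega⟩
        · exact ⟨2, by omega⟩
      · rw [hrest ω h0 h1]
        exact ⟨m ω₀ + 1, by omega⟩

namespace Matrix.SpecialLinearGroup

variable {K : Type*} [Field K]

/-- The point at infinity of the projective line. -/
def pointAtInfty (K : Type*) [Field K] : ℙ K (Fin 2 → K) :=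
  Projectivization.mk K ![1, 0] (fun h => one_ne_zero (congrFun h 0))

theorem smul_mk_eq_self_iff (g : SL(2, K)) {v : Fin 2 → K} (hv : v ≠ 0) :
    g • Projectivization.mk K v hv = Projectivization.mk K v hv ↔
      ∃ t : K, g 0 0 * v 0 + g 0 1 * v 1 = t * v 0 ∧ g 1 0 * v 0 + g 1 1 * v 1 = t * v 1 := by
  rw [Projectivization.smul_mk, Projectivization.mk_eq_mk_iff']
  refine exists_congr fun t => ?_
  rw [Matrix.SpecialLinearGroup.smul_def]
  simp [funext_iff, Fin.forall_fin_two, eq_comm]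

theorem smul_pointAtInfty_eq_self_iff (g : SL(2, K)) :
    g • pointAtInfty K = pointAtInfty K ↔ g 1 0 = 0 := by
  rw [pointAtInfty, smul_mk_eq_self_iff]
  simp

theorem exists_smul_pointAtInfty_eq (x : ℙ K (Fin 2 → K)) :
    ∃ k : SL(2, K), k • pointAtInfty K = x := by
  induction x using Projectivization.ind with
  | h v hv =>
    have hcop : IsCoprime (v 0) (v 1) := by
      by_cases h : v 0 = 0
      · have h1 : v 1 ≠ 0 := fun h1 => hv (by ext i; fin_cases i <;> simp [h, h1])
        exact ⟨0, (v 1)⁻¹, by simp [h1]⟩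
      · exact ⟨(v 0)⁻¹, 0, by simp [h]⟩
    obtain ⟨k, h0, h1⟩ := hcop.exists_SL2_col 0
    refine ⟨k, ?_⟩
    rw [pointAtInfty, Projectivization.smul_mk, Projectivization.mk_eq_mk_iff']
    refine ⟨1, ?_⟩
    rw [Matrix.SpecialLinearGroup.smul_def]
    ext i; fin_cases i <;>
      simp [Matrix.mulVec, dotProduct, Fin.sum_univ_two, h0, h1]

theorem smul_eq_self_iff_of_smul_pointAtInfty (g k : SL(2, K)) {x : ℙ K (Fin 2 → K)}
    (hk : k • pointAtInfty K = x) : g • x = x ↔ (k⁻¹ * g * k) 1 0 = 0 := by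
  rw [← smul_pointAtInfty_eq_self_iff, mul_smul, mul_smul, hk, inv_smul_eq_iff, hk]

theorem trace_conj (g k : SL(2, K)) :
    Matrix.trace (k⁻¹ * g * k : SL(2, K)).1 = Matrix.trace g.1 := by
  rw [coe_mul, Matrix.trace_mul_comm, ← coe_mul]
  group

theorem det_fin_two_eq (g : SL(2, K)) : g 0 0 * g 1 1 - g 0 1 * g 1 0 = 1 := by
  rw [← Matrix.det_fin_two]; exact g.2

theorem eq_one_or_neg_one_of_entries {g : SL(2, K)} (h10 : g 1 0 = 0) (h01 : g 0 1 = 0)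
    (h : g 0 0 = g 1 1) : g = 1 ∨ g = -1 := by
  have hd := det_fin_two_eq g
  rw [h10, ← h] at hd
  have : (g 0 0 - 1) * (g 0 0 + 1) = 0 := by linear_combination hd
  rcases mul_eq_zero.1 this with h1 | h1
  · left
    have h1 : g 0 0 = 1 := by linear_combination h1
    ext i j; fin_cases i <;> fin_cases j <;> simp [h10, h01, ← h, h1]
  · right
    have h1 : g 0 0 = -1 := by linear_combination h1
    ext i j; fin_cases i <;> fin_cases j <;> simp [h10, h01, ← h, h1]

theorem exists_fixed_point {g : SL(2, K)} {a : K} (ha : a ≠ 0)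
    (ht : Matrix.trace g.1 = a + a⁻¹) : ∃ x : ℙ K (Fin 2 → K), g • x = x := by
  have hdet : (g.1 - Matrix.scalar (Fin 2) a).det = 0 := by
    have hd := det_fin_two_eq g
    rw [Matrix.trace_fin_two] at ht
    rw [Matrix.det_fin_two]
    simp
    linear_combination hd - a * ht - mul_inv_cancel₀ ha
  obtain ⟨v, hv, h⟩ := Matrix.exists_mulVec_eq_zero_iff.2 hdet
  refine ⟨Projectivization.mk K v hv, (smul_mk_eq_self_iff g hv).2 ⟨a, ?_⟩⟩
  have h0 := congrFun h 0
  have h1 := congrFun h 1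
  simp [Matrix.mulVec, dotProduct, Fin.sum_univ_two] at h0 h1
  exact ⟨by linear_combination h0, by linear_combination h1⟩

open Classical in
theorem card_fixed_points_of_entries [Fintype (ℙ K (Fin 2 → K))]
    {g : SL(2, K)} (h10 : g 1 0 = 0) (h1 : g ≠ 1) (h1' : g ≠ -1) :
    (Finset.univ.filter fun x : ℙ K (Fin 2 → K) => g • x = x).card +
      (Finset.univ.filter fun x : ℙ K (Fin 2 → K) =>
        g • x = x ∧ Matrix.trace g.1 ^ 2 = 4).card = 2 := by
  have hd := det_fin_two_eq g
  rw [h10] at hd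
  have htr : Matrix.trace g.1 ^ 2 = 4 ↔ g 0 0 = g 1 1 := by
    rw [Matrix.trace_fin_two, ← sub_eq_zero (a := g 0 0), ← pow_eq_zero_iff two_ne_zero]
    constructor <;> intro h
    · linear_combination h - 4 * hd
    · linear_combination h + 4 * hd
  by_cases hab : g 0 0 = g 1 1
  · have h01 : g 0 1 ≠ 0 := fun h01 => by
      rcases eq_one_or_neg_one_of_entries h10 h01 hab with h | h
      · exact h1 h
      · exact h1' h
    have hs : (Finset.univ.filter fun x : ℙ K (Fin 2 → K) => g • x = x) = {pointAtInfty K} := by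
      ext x
      simp only [Finset.mem_filter, Finset.mem_univ, true_and, Finset.mem_singleton]
      constructor
      · intro hx
        induction x using Projectivization.ind with
        | h v hv =>
          obtain ⟨t, e0, e1⟩ := (smul_mk_eq_self_iff g hv).1 hx
          have hv1 : v 1 = 0 := by
            by_contra hv1
            rw [h10] at e1
            have : t = g 1 1 := mul_right_cancel₀ hv1 (by linear_combination -e1)
            have : g 0 1 * v 1 = 0 := by rw [this, hab] at e0; linear_combination e0
            exact (mul_ne_zero h01 hv1) this
          rw [pointAtInfty, Projectivization.mk_eq_mk_iff']
          exact ⟨v 0, by ext i; fin_cases i <;> simp [hv1]⟩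
      · rintro rfl
        exact (smul_pointAtInfty_eq_self_iff g).2 h10
    have hs' : (Finset.univ.filter fun x : ℙ K (Fin 2 → K) =>
        g • x = x ∧ Matrix.trace g.1 ^ 2 = 4) = {pointAtInfty K} := by
      rw [← hs]; congr 1; ext x; simp [htr.2 hab]
    rw [hs, hs']; simp
  · have hs' : (Finset.univ.filter fun x : ℙ K (Fin 2 → K) =>
        g • x = x ∧ Matrix.trace g.1 ^ 2 = 4) = ∅ := by
      simp [htr, hab]
    have hne : g 1 1 - g 0 0 ≠ 0 := fun h => hab (by linear_combination -h)
    have hq : ![g 0 1, g 1 1 - g 0 0] ≠ 0 := fun h => hne (by simpa using congrFun h 1)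
    have hs : (Finset.univ.filter fun x : ℙ K (Fin 2 → K) => g • x = x) =
        {pointAtInfty K, Projectivization.mk K _ hq} := by
      ext x
      simp only [Finset.mem_filter, Finset.mem_univ, true_and, Finset.mem_insert,
        Finset.mem_singleton]
      constructor
      · intro hx
        induction x using Projectivization.ind with
        | h v hv =>
          obtain ⟨t, e0, e1⟩ := (smul_mk_eq_self_iff g hv).1 hx
          by_cases hv1 : v 1 = 0
          · left
            rw [pointAtInfty, Projectivization.mk_eq_mk_iff']
            exact ⟨v 0, by ext i; fin_cases i <;> simp [hv1]⟩
          · right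
            rw [h10] at e1
            have : t = g 1 1 := mul_right_cancel₀ hv1 (by linear_combination -e1)
            rw [this] at e0
            rw [Projectivization.mk_eq_mk_iff']
            refine ⟨v 1 / (g 1 1 - g 0 0), ?_⟩
            ext i; fin_cases i
            · simp only [Fin.zero_eta, Pi.smul_apply, Matrix.cons_val_zero, smul_eq_mul]
              rw [div_mul_eq_mul_div, div_eq_iff hne]
              linear_combination e0
            · exact div_mul_cancel₀ _ hne
      · rintro (rfl | rfl)
        · exact (smul_pointAtInfty_eq_self_iff g).2 h10
        · refine (smul_mk_eq_self_iff g hq).2 ⟨g 1 1, ?_, ?_⟩ <;> simp [h10]; ring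
    rw [hs, hs', Finset.card_empty, Finset.card_pair]
    intro h
    rw [pointAtInfty, Projectivization.mk_eq_mk_iff'] at h
    obtain ⟨a, ha⟩ := h
    have h0 := congrFun ha 0
    have h1 := congrFun ha 1
    simp at h0 h1
    rcases h1 with h1 | h1
    · simp [h1] at h0
    · exact hne h1

open Classical in
theorem card_fixed_points [Fintype (ℙ K (Fin 2 → K))] {g : SL(2, K)}
    {a : K} (ha : a ≠ 0) (ht : Matrix.trace g.1 = a + a⁻¹) (h1 : g ≠ 1) (h1' : g ≠ -1) :
    (Finset.univ.filter fun x : ℙ K (Fin 2 → K) => g • x = x).card +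
      (Finset.univ.filter fun x : ℙ K (Fin 2 → K) =>
        g • x = x ∧ Matrix.trace g.1 ^ 2 = 4).card = 2 := by
  obtain ⟨x, hx⟩ := exists_fixed_point ha ht
  obtain ⟨k, hk⟩ := exists_smul_pointAtInfty_eq x
  have h10 := (smul_eq_self_iff_of_smul_pointAtInfty g k hk).1 hx
  have key := card_fixed_points_of_entries h10
    (fun h => h1 (by simpa [mul_assoc, inv_mul_eq_one, eq_comm] using h))
    (fun h => h1' (by
      have : g = k * (k⁻¹ * g * k) * k⁻¹ := by group
      rw [this, h]; simp))
  rw [trace_conj] at key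
  refine Eq.trans ?_ key
  have hiff : ∀ y : ℙ K (Fin 2 → K), (k⁻¹ * g * k) • (k⁻¹ • y) = k⁻¹ • y ↔ g • y = y := fun y => by
    rw [mul_smul, mul_smul, smul_inv_smul, smul_left_cancel_iff]
  congr 1
  · refine Finset.card_bij (fun y _ => k⁻¹ • y) ?_ ?_ ?_
    · intro y hy; simpa [hiff] using hy
    · intro y _ z _ h; exact smul_left_cancel _ h
    · intro z hz
      refine ⟨k • z, ?_, by simp⟩
      have := hiff (k • z)
      simp only [inv_smul_smul] at this
      simpa [← this] using hz
  · refine Finset.card_bij (fun y _ => k⁻¹ • y) ?_ ?_ ?_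
    · intro y hy; simpa [hiff] using hy
    · intro y _ z _ h; exact smul_left_cancel _ h
    · intro z hz
      refine ⟨k • z, ?_, by simp⟩
      have := hiff (k • z)
      simp only [inv_smul_smul] at this
      simpa [← this] using hz


variable {K : Type*} [Field K]

section Multiplier

variable (Γ : Subgroup SL(2, K)) (k : SL(2, K))

theorem conj_entry_eq_zero (g : stabilizer Γ (k • pointAtInfty K)) :
    (k⁻¹ * ((g : Γ) : SL(2, K)) * k) 1 0 = 0 :=
  (smul_eq_self_iff_of_smul_pointAtInfty ((g : Γ) : SL(2, K)) k rfl).1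
    (mem_stabilizer_iff.1 g.2)

theorem conj_mul (g h : SL(2, K)) : k⁻¹ * (g * h) * k = (k⁻¹ * g * k) * (k⁻¹ * h * k) := by
  group

/-- The eigenvalue by which an element of the stabilizer of a point of the projective line acts on
the corresponding line. -/
noncomputable def multiplier : stabilizer Γ (k • pointAtInfty K) →* Kˣ :=
  MonoidHom.toHomUnits
    { toFun := fun g => (k⁻¹ * ((g : Γ) : SL(2, K)) * k) 0 0
      map_one' := by simp
      map_mul' := fun g h => by
        have h0 := conj_entry_eq_zero Γ k h
        rw [Subgroup.coe_mul, Subgroup.coe_mul, conj_mul, coe_mul, Matrix.mul_apply,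
          Fin.sum_univ_two, h0, mul_zero, add_zero] }

theorem coe_multiplier (g : stabilizer Γ (k • pointAtInfty K)) :
    (multiplier Γ k g : K) = (k⁻¹ * ((g : Γ) : SL(2, K)) * k) 0 0 := rfl

theorem coe_inv_multiplier (g : stabilizer Γ (k • pointAtInfty K)) :
    ((multiplier Γ k g)⁻¹ : Kˣ) = (k⁻¹ * ((g : Γ) : SL(2, K)) * k) 1 1 := by
  have hd := det_fin_two_eq (k⁻¹ * ((g : Γ) : SL(2, K)) * k)
  rw [conj_entry_eq_zero Γ k g, ← coe_multiplier, mul_zero, sub_zero] at hd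
  rw [Units.val_inv_eq_inv_val]
  exact inv_eq_of_mul_eq_one_right hd

theorem trace_eq_multiplier (g : stabilizer Γ (k • pointAtInfty K)) :
    Matrix.trace (g : Γ).1.1 = multiplier Γ k g + (multiplier Γ k g : K)⁻¹ := by
  rw [← trace_conj _ k, Matrix.trace_fin_two, ← Units.val_inv_eq_inv_val, coe_inv_multiplier,
    coe_multiplier]

theorem trace_sq_eq_four_iff (g : stabilizer Γ (k • pointAtInfty K)) :
    Matrix.trace (g : Γ).1.1 ^ 2 = 4 ↔ multiplier Γ k g ^ 2 = 1 := by
  rw [trace_eq_multiplier, Units.ext_iff, Units.val_pow_eq_pow_val, Units.val_one]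
  have h0 := (multiplier Γ k g).ne_zero
  generalize (multiplier Γ k g : K) = a at *
  have e : (a ^ 2 - 1) ^ 2 = a ^ 2 * ((a + a⁻¹) ^ 2 - 4) := by
    field_simp; ring
  rw [← sub_eq_zero, ← sub_eq_zero (a := a ^ 2)]
  constructor
  · intro h; rw [h, mul_zero] at e; exact pow_eq_zero_iff two_ne_zero |>.1 e
  · intro h
    rw [h] at e
    exact (mul_eq_zero.1 (by simpa using e.symm)).resolve_left (pow_ne_zero 2 h0)

theorem eq_one_of_multiplier_eq_one {g : stabilizer Γ (k • pointAtInfty K)}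
    (hg : multiplier Γ k g = 1) (h : (k⁻¹ * ((g : Γ) : SL(2, K)) * k) 0 1 = 0) : g = 1 := by
  have h0 := coe_multiplier Γ k g
  have h1 := coe_inv_multiplier Γ k g
  rw [hg] at h0 h1
  have : k⁻¹ * ((g : Γ) : SL(2, K)) * k = 1 := by
    ext i j
    fin_cases i <;> fin_cases j
    · simpa using h0.symm
    · simpa using h
    · simpa using conj_entry_eq_zero Γ k g
    · simpa using h1.symm
  have : ((g : Γ) : SL(2, K)) = 1 := by
    have e : ((g : Γ) : SL(2, K)) = k * (k⁻¹ * ((g : Γ) : SL(2, K)) * k) * k⁻¹ := by group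
    rw [e, this]; simp
  exact Subtype.ext (Subtype.ext this)

theorem eq_one_of_multiplier_eq_one_of_smul_eq {g : stabilizer Γ (k • pointAtInfty K)}
    (hg : multiplier Γ k g = 1) {y : ℙ K (Fin 2 → K)} (hy : y ≠ k • pointAtInfty K)
    (hgy : (g : Γ) • y = y) : g = 1 := by
  refine eq_one_of_multiplier_eq_one Γ k hg ?_
  have h0 := coe_multiplier Γ k g
  have h1 := coe_inv_multiplier Γ k g
  have h10 := conj_entry_eq_zero Γ k g
  rw [hg] at h0 h1
  have hfix : (k⁻¹ * ((g : Γ) : SL(2, K)) * k) • (k⁻¹ • y) = k⁻¹ • y := by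
    rw [mul_smul, mul_smul, smul_inv_smul]
    exact congrArg _ hgy
  have hne : k⁻¹ • y ≠ pointAtInfty K := fun h => hy (by rw [← h, smul_inv_smul])
  generalize k⁻¹ * ((g : Γ) : SL(2, K)) * k = h at *
  generalize k⁻¹ • y = z at *
  induction z using Projectivization.ind with
  | h v hv =>
    obtain ⟨t, e0, e1⟩ := (smul_mk_eq_self_iff h hv).1 hfix
    have hv1 : v 1 ≠ 0 := fun hv1 => hne (by
      rw [pointAtInfty, Projectivization.mk_eq_mk_iff']
      exact ⟨v 0, by ext i; fin_cases i <;> simp [hv1]⟩)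
    rw [h10, ← h1] at e1
    rw [← h0] at e0
    have ht : t = 1 := mul_right_cancel₀ hv1 (by simp at e1; linear_combination -e1)
    rw [ht] at e0
    exact (mul_eq_zero.1 (by simp at e0; simpa using e0 : h 0 1 * v 1 = 0)).resolve_right hv1

theorem pow_char_eq_one_of_multiplier_eq_one (p : ℕ) [CharP K p]
    {g : stabilizer Γ (k • pointAtInfty K)} (hg : multiplier Γ k g = 1) : g ^ p = 1 := by
  have hb : ∀ n : ℕ, (k⁻¹ * (((g ^ n : stabilizer Γ (k • pointAtInfty K)) : Γ) : SL(2, K)) * k) 0 1 =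
      n * (k⁻¹ * ((g : Γ) : SL(2, K)) * k) 0 1 := fun n => by
    induction n with
    | zero => simp
    | succ n ih =>
      have h0 := coe_multiplier Γ k (g ^ n)
      have h1 := coe_inv_multiplier Γ k g
      rw [map_pow, hg, one_pow] at h0
      rw [hg] at h1
      rw [pow_succ, Subgroup.coe_mul, Subgroup.coe_mul, conj_mul, coe_mul, Matrix.mul_apply,
        Fin.sum_univ_two, ih, ← h0, ← h1]
      push_cast; simp; ring
  refine eq_one_of_multiplier_eq_one Γ k (by rw [map_pow, hg, one_pow]) ?_
  rw [hb, CharP.cast_eq_zero, zero_mul]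

theorem conj_entry_of_multiplier_eq_one {g u : stabilizer Γ (k • pointAtInfty K)}
    (hu : multiplier Γ k u = 1) :
    (k⁻¹ * (((g * u * g⁻¹ : stabilizer Γ (k • pointAtInfty K)) : Γ) : SL(2, K)) * k) 0 1 =
      ((multiplier Γ k g ^ 2 : Kˣ) : K) * (k⁻¹ * ((u : Γ) : SL(2, K)) * k) 0 1 := by
  have e : k⁻¹ * ((g * u * g⁻¹ : stabilizer Γ (k • pointAtInfty K)) : Γ).1 * k =
      (k⁻¹ * ((g : Γ) : SL(2, K)) * k) * (k⁻¹ * ((u : Γ) : SL(2, K)) * k) * (k⁻¹ * ((g : Γ) : SL(2, K)) * k)⁻¹ := by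
    push_cast; group
  have h0 := coe_multiplier Γ k u
  have h1 := coe_inv_multiplier Γ k u
  have hu10 := conj_entry_eq_zero Γ k u
  have hg10 := conj_entry_eq_zero Γ k g
  have hd := det_fin_two_eq (k⁻¹ * ((g : Γ) : SL(2, K)) * k)
  rw [hu] at h0 h1
  rw [e, Units.val_pow_eq_pow_val, coe_multiplier]
  generalize k⁻¹ * ((g : Γ) : SL(2, K)) * k = a at *
  generalize k⁻¹ * ((u : Γ) : SL(2, K)) * k = b at *
  simp only [coe_mul, coe_inv, Matrix.mul_apply, Fin.sum_univ_two, Matrix.adjugate_fin_two,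
    hu10, hg10, ← h0, ← h1]
  simp
  ring

end Multiplier

theorem stabilizer_structure [Finite K] (p : ℕ) [Fact p.Prime] [CharP K p] (hp : p ≠ 2)
    (Γ : Subgroup SL(2, K)) (hneg : -1 ∈ Γ) (x : ℙ K (Fin 2 → K))
    (hx : 2 ≤ Nat.card (orbit Γ x)) :
    ∃ m n : ℕ, 1 ≤ n ∧ Nat.card (stabilizer Γ x) = 2 * m * n ∧
      Nat.card {g : Γ // g • x = x ∧ Matrix.trace g.1.1 ^ 2 = 4} = 2 * m ∧ (∃ k, m = p ^ k) ∧
      (m ≠ 1 → n ≤ m - 1 ∧ m + 1 ≤ Nat.card (orbit Γ x)) ∧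
      ∀ g : Γ, g • x = x → ∃ a : K, a ≠ 0 ∧ Matrix.trace g.1.1 = a + a⁻¹ ∧ a ^ (2 * n) = 1 := by
  obtain ⟨k, rfl⟩ := exists_smul_pointAtInfty_eq x
  set χ := multiplier Γ k with hχ
  set ψ := (powMonoidHom 2).comp χ with hψ
  have h2 : (2 : K) ≠ 0 := Ring.two_ne_zero (by rwa [ringChar.eq K p])
  have hneg1 : (-1 : Kˣ) ≠ 1 := fun h => h2 (by
    have := congrArg Units.val h
    simp at this
    linear_combination -this)
  have hψ1 : ∀ g, ψ g = 1 ↔ χ g ^ 2 = 1 := fun g => Iff.rfl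
  let ν : stabilizer Γ (k • pointAtInfty K) := ⟨⟨-1, hneg⟩, by
    rw [mem_stabilizer_iff]
    exact (smul_eq_self_iff_of_smul_pointAtInfty (-1) k rfl).2 (by simp)⟩
  have hν : χ ν = -1 := by
    ext
    rw [hχ, coe_multiplier]
    simp [ν]
  have hker : Nat.card ψ.ker = 2 * Nat.card χ.ker := by
    have hle : χ.ker ≤ ψ.ker := fun g hg => by
      rw [MonoidHom.mem_ker] at hg ⊢
      rw [hψ1, hg, one_pow]
    have e1 := Subgroup.card_mul_index (χ.comp ψ.ker.subtype).ker
    have e2 : Nat.card (χ.comp ψ.ker.subtype).ker = Nat.card χ.ker :=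
      Nat.card_congr (Subgroup.subgroupOfEquivOfLe hle).toEquiv
    have e3 : ((χ.comp ψ.ker.subtype).range : Set Kˣ) = {1, -1} := by
      ext a
      simp only [SetLike.mem_coe, MonoidHom.mem_range, Set.mem_insert_iff, Set.mem_singleton_iff]
      constructor
      · rintro ⟨g, rfl⟩
        have hg : χ g.1 ^ 2 = 1 := g.2
        have hg' := congrArg Units.val hg
        rw [Units.val_pow_eq_pow_val, Units.val_one, sq_eq_one_iff] at hg'
        rcases hg' with h | h
        · exact Or.inl (Units.ext h)
        · exact Or.inr (Units.ext h)
      · rintro (rfl | rfl)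
        · exact ⟨1, map_one _⟩
        · exact ⟨⟨ν, by rw [MonoidHom.mem_ker, hψ1, hν]; simp⟩, hν⟩
    have e4 : Nat.card (χ.comp ψ.ker.subtype).range = 2 := by
      change Nat.card ((χ.comp ψ.ker.subtype).range : Set Kˣ) = 2
      rw [e3, Nat.card_coe_set_eq, Set.ncard_pair hneg1.symm]
    rw [Subgroup.index_ker, e2, e4] at e1
    rw [← e1, mul_comm]
  have hcard : Nat.card (stabilizer Γ (k • pointAtInfty K)) =
      2 * Nat.card χ.ker * Nat.card ψ.range := by
    rw [← hker, ← Subgroup.index_ker, Subgroup.card_mul_index]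
  refine ⟨Nat.card χ.ker, Nat.card ψ.range, Nat.card_pos, hcard, ?_, ?_, ?_, ?_⟩
  · rw [← hker]
    refine Nat.card_congr
      { toFun := fun g => ⟨⟨g.1, g.2.1⟩, (trace_sq_eq_four_iff Γ k ⟨g.1, g.2.1⟩).1 g.2.2⟩
        invFun := fun g => ⟨g.1.1, g.1.2, (trace_sq_eq_four_iff Γ k g.1).2 g.2⟩
        left_inv := fun _ => rfl
        right_inv := fun _ => rfl }
  · refine IsPGroup.iff_card.1 fun g => ⟨1, ?_⟩
    rw [pow_one]
    exact Subtype.ext (pow_char_eq_one_of_multiplier_eq_one Γ k p g.2)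
  · intro hm
    have hm1 : 1 < Nat.card χ.ker := by
      have := Nat.card_pos (α := χ.ker); omega
    have : Nontrivial χ.ker := Finite.one_lt_card_iff_nontrivial.1 hm1
    have hnt := exists_ne (1 : χ.ker)
    obtain ⟨u, hu⟩ := hnt
    constructor
    · have hub : (k⁻¹ * (((u : stabilizer Γ (k • pointAtInfty K)) : Γ) : SL(2, K)) * k) 0 1 ≠ 0 := fun h =>
        hu (Subtype.ext (eq_one_of_multiplier_eq_one Γ k u.2 h))
      choose s hs using fun a : ψ.range => a.2
      have hmem : ∀ g, g * (u : stabilizer Γ (k • pointAtInfty K)) * g⁻¹ ∈ χ.ker := fun g =>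
        (inferInstance : χ.ker.Normal).conj_mem _ u.2 g
      let F : ψ.range → {v : χ.ker // v ≠ 1} := fun a => ⟨⟨_, hmem (s a)⟩, fun h => hu (by
        have := congrArg Subtype.val h
        simp at this
        exact this)⟩
      have hF : Function.Injective F := fun a b hab => by
        have h1 : s a * u.1 * (s a)⁻¹ = s b * u.1 * (s b)⁻¹ :=
          congrArg (fun z => z.1.1) hab
        have ha := conj_entry_of_multiplier_eq_one Γ k (g := s a) u.2
        have hb := conj_entry_of_multiplier_eq_one Γ k (g := s b) u.2
        rw [h1, hb] at ha
        have := Units.ext (mul_right_cancel₀ hub ha)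
        exact Subtype.ext ((hs a).symm.trans (this.symm.trans (hs b)))
      have := Nat.card_le_card_of_injective F hF
      have e : Nat.card {v : χ.ker // v ≠ 1} = Nat.card χ.ker - 1 := by
        have : Fintype χ.ker := Fintype.ofFinite _
        classical
        rw [Nat.card_eq_fintype_card, Nat.card_eq_fintype_card, Fintype.card_subtype_compl,
          Fintype.card_subtype_eq]
      omega
    · obtain ⟨y, hy⟩ : ∃ y : orbit Γ (k • pointAtInfty K), y.1 ≠ k • pointAtInfty K := by
        by_contra! hcon
        have : Subsingleton (orbit Γ (k • pointAtInfty K)) :=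
          ⟨fun a b => Subtype.ext ((hcon a).trans (hcon b).symm)⟩
        have := Finite.card_le_one_iff_subsingleton.2 this
        omega
      let F : Option χ.ker → orbit Γ (k • pointAtInfty K) := fun o =>
        o.elim ⟨_, mem_orbit_self _⟩ fun v => (v.1 : Γ) • y
      have hF : Function.Injective F := by
        rintro (_ | v) (_ | w) h
        · rfl
        · exfalso
          have h : k • pointAtInfty K = (w.1 : Γ) • y.1 := congrArg Subtype.val h
          have hw : (w.1 : Γ) • (k • pointAtInfty K) = k • pointAtInfty K := w.1.2
          exact hy (smul_left_cancel _ (h.symm.trans hw.symm))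
        · exfalso
          have h : (v.1 : Γ) • y.1 = k • pointAtInfty K := congrArg Subtype.val h
          have hw : (v.1 : Γ) • (k • pointAtInfty K) = k • pointAtInfty K := v.1.2
          exact hy (smul_left_cancel _ (h.trans hw.symm))
        · have h : (v.1 : Γ) • y.1 = (w.1 : Γ) • y.1 := congrArg Subtype.val h
          have h' : ((w⁻¹ * v : χ.ker).1 : Γ) • y.1 = y.1 := by
            push_cast
            rw [mul_smul, h, inv_smul_smul]
          have := eq_one_of_multiplier_eq_one_of_smul_eq Γ k (w⁻¹ * v).2 hy h'
          have : w⁻¹ * v = 1 := Subtype.ext this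
          rw [inv_mul_eq_one.1 this]
      have := Nat.card_le_card_of_injective F hF
      rwa [Finite.card_option] at this
  · intro g hg
    refine ⟨χ ⟨g, hg⟩, Units.ne_zero _, trace_eq_multiplier Γ k ⟨g, hg⟩, ?_⟩
    have : (⟨ψ ⟨g, hg⟩, ⟨_, rfl⟩⟩ : ψ.range) ^ Nat.card ψ.range = 1 := pow_card_eq_one'
    have := congrArg (fun z => (z.1 : K)) this
    rw [pow_mul]
    simpa [hψ] using this

end Matrix.SpecialLinearGroup

theorem MulAction.sum_eq_sum_orbits {G X : Type*} [Group G] [MulAction G X] [Fintype X]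
    [Fintype (orbitRel.Quotient G X)] (F : X → ℚ) (hF : ∀ (g : G) x, F (g • x) = F x) :
    ∑ x, F x = ∑ ω : orbitRel.Quotient G X, (Nat.card (orbit G ω.out) : ℚ) * F ω.out := by
  classical
  rw [← Finset.sum_fiberwise Finset.univ (fun x : X => (Quotient.mk'' x : orbitRel.Quotient G X)) F]
  refine Finset.sum_congr rfl fun ω _ => ?_
  have hmem : ∀ x : X, (Quotient.mk'' x : orbitRel.Quotient G X) = ω ↔ x ∈ orbit G ω.out :=
    fun x => by
      conv_lhs => rw [← Quotient.out_eq' ω]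
      rw [Quotient.eq'', orbitRel_apply]
  rw [Finset.sum_congr rfl (g := fun _ => F ω.out)]
  · rw [Finset.sum_const, nsmul_eq_mul, Nat.card_eq_fintype_card, Fintype.card_subtype]
    simp only [hmem]
  · intro x hx
    obtain ⟨g, hg⟩ := (hmem x).1 (Finset.mem_filter.1 hx).2
    rw [← hg]
    exact hF g _

namespace Matrix.SpecialLinearGroup

variable {K : Type*} [Field K]

theorem card_fixing_trace_smul (Γ : Subgroup SL(2, K)) (h : Γ) (x : ℙ K (Fin 2 → K)) :
    Nat.card {g : Γ // g • (h • x) = h • x ∧ Matrix.trace g.1.1 ^ 2 = 4} =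
      Nat.card {g : Γ // g • x = x ∧ Matrix.trace g.1.1 ^ 2 = 4} := by
  refine Nat.card_congr ((MulAut.conj h⁻¹).toEquiv.subtypeEquiv fun g => ?_)
  have e : Matrix.trace ((MulAut.conj h⁻¹ g : Γ) : SL(2, K)).1 = Matrix.trace g.1.1 := by
    rw [← trace_conj g.1 h.1]
    simp
  change _ ↔ (MulAut.conj h⁻¹ g) • x = x ∧ Matrix.trace ((MulAut.conj h⁻¹ g : Γ) : SL(2, K)).1 ^ 2 = 4
  rw [e, MulAut.conj_apply, inv_inv, mul_smul, mul_smul, inv_smul_eq_iff]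

open Classical in
theorem sum_card_stabilizer_add [Finite K] (h2 : (2 : K) ≠ 0) [Fintype (ℙ K (Fin 2 → K))]
    (Γ : Subgroup SL(2, K)) (hneg : -1 ∈ Γ)
    (htr : ∀ g ∈ Γ, ∃ a : K, a ≠ 0 ∧ Matrix.trace g.1 = a + a⁻¹) :
    ∑ x : ℙ K (Fin 2 → K), ((Nat.card (stabilizer Γ x) : ℚ) +
      Nat.card {g : Γ // g • x = x ∧ Matrix.trace g.1.1 ^ 2 = 4} - 4) =
      2 * Nat.card Γ - 4 := by
  have : Fintype Γ := Fintype.ofFinite _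
  have hne : (1 : Γ) ≠ ⟨-1, hneg⟩ := fun h => h2 (by
    have := congrArg (fun g : Γ => g.1.1 0 0) h
    simp at this
    linear_combination this)
  have e1 : ∀ x : ℙ K (Fin 2 → K), ((Nat.card (stabilizer Γ x) : ℚ) +
      Nat.card {g : Γ // g • x = x ∧ Matrix.trace g.1.1 ^ 2 = 4}) =
      ∑ g : Γ, ((if g • x = x then 1 else 0) +
        (if g • x = x ∧ Matrix.trace g.1.1 ^ 2 = 4 then 1 else 0)) := fun x => by
    rw [Finset.sum_add_distrib, Finset.sum_boole, Finset.sum_boole, Nat.card_eq_fintype_card,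
      Nat.card_eq_fintype_card, Fintype.card_subtype, Fintype.card_subtype]
    rfl
  have e2 : ∀ g : Γ, ∑ x : ℙ K (Fin 2 → K), ((if g • x = x then (1 : ℚ) else 0) +
        (if g • x = x ∧ Matrix.trace g.1.1 ^ 2 = 4 then 1 else 0)) =
      2 + (if g = 1 then 2 * (Fintype.card (ℙ K (Fin 2 → K)) : ℚ) - 2 else 0) +
        (if g = ⟨-1, hneg⟩ then 2 * (Fintype.card (ℙ K (Fin 2 → K)) : ℚ) - 2 else 0) := fun g => by
    rw [Finset.sum_add_distrib, Finset.sum_boole, Finset.sum_boole]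
    have hs : ∀ s : K, s ^ 2 = 1 → g.1.1 = Matrix.scalar (Fin 2) s → 
        ∀ x : ℙ K (Fin 2 → K), g • x = x ∧ Matrix.trace g.1.1 ^ 2 = 4 := fun s hs hg x => by
      constructor
      · induction x using Projectivization.ind with
        | h v hv =>
          refine (smul_mk_eq_self_iff g.1 hv).2 ⟨s, ?_⟩
          rw [hg]; simp
      · rw [hg]
        simp
        linear_combination 4 * hs
    by_cases h1 : g = 1
    · subst h1
      have := hs 1 (by simp) (by simp)
      rw [Finset.filter_true_of_mem fun x _ => (this x).1,
        Finset.filter_true_of_mem fun x _ => this x, if_pos rfl, if_neg hne, Finset.card_univ]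
      ring
    by_cases h1' : g = ⟨-1, hneg⟩
    · subst h1'
      have := hs (-1) (by simp) (by ext i j; fin_cases i <;> fin_cases j <;> simp)
      rw [Finset.filter_true_of_mem fun x _ => (this x).1,
        Finset.filter_true_of_mem fun x _ => this x, if_pos rfl, if_neg hne.symm, Finset.card_univ]
      ring
    · obtain ⟨a, ha, hta⟩ := htr g.1 g.2
      have := card_fixed_points ha hta (fun h => h1 (Subtype.ext h))
        (fun h => h1' (Subtype.ext h))
      rw [if_neg h1, if_neg h1', add_zero, add_zero]
      exact_mod_cast this
  rw [Finset.sum_sub_distrib, Finset.sum_congr rfl fun x _ => e1 x, Finset.sum_comm,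
    Finset.sum_congr rfl fun g _ => e2 g]
  simp only [Finset.sum_add_distrib, Finset.sum_ite_eq', Finset.mem_univ, if_true,
    Finset.sum_const, Finset.card_univ, nsmul_eq_mul, Nat.card_eq_fintype_card]
  ring

theorem trace_pow_of_pow_eq_one (p : ℕ) [Fact p.Prime] [CharP K p] {a : K} (ha : a ≠ 0) {l k : ℕ}
    (hl : a ^ l = 1) (h : l ∣ 2 * (p ^ k - 1) ∨ l ∣ 2 * (p ^ k + 1)) :
    (a + a⁻¹) ^ p ^ k = a + a⁻¹ ∨ (a + a⁻¹) ^ p ^ k = -(a + a⁻¹) := by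
  have hpk : 1 ≤ p ^ k := Nat.one_le_pow _ _ (Fact.out : p.Prime).pos
  rw [add_pow_char_pow, inv_pow]
  rcases h with ⟨c, hc⟩ | ⟨c, hc⟩
  · have h1 : (a ^ (p ^ k - 1)) ^ 2 = 1 := by
      rw [← pow_mul, mul_comm, hc, pow_mul, hl, one_pow]
    have e : a ^ p ^ k = a ^ (p ^ k - 1) * a := by rw [← pow_succ, Nat.sub_add_cancel hpk]
    rcases sq_eq_one_iff.1 h1 with h | h
    · left; rw [e, h, one_mul]
    · right; rw [e, h]; simp; ring
  · have h1 : (a ^ (p ^ k + 1)) ^ 2 = 1 := by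
      rw [← pow_mul, mul_comm, hc, pow_mul, hl, one_pow]
    have e : a ^ p ^ k = a ^ (p ^ k + 1) * a⁻¹ := by rw [pow_succ, mul_inv_cancel_right₀ ha]
    rcases sq_eq_one_iff.1 h1 with h | h
    · left; rw [e, h, one_mul, inv_inv, add_comm]
    · right; rw [e, h]; simp

/-- A weak form of Dickson's classification of subgroups of `SL(2, K)`. -/
theorem trace_of_three_le_orbit [Finite K] (p : ℕ) [Fact p.Prime] [CharP K p] (hp : 7 ≤ p)
    (Γ : Subgroup SL(2, K)) (hneg : -1 ∈ Γ)
    (htr : ∀ g ∈ Γ, ∃ a : K, a ≠ 0 ∧ Matrix.trace g.1 = a + a⁻¹)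
    (horb : ∀ x : ℙ K (Fin 2 → K), 3 ≤ Nat.card (orbit Γ x)) :
    (∀ g ∈ Γ, ∃ n : ℕ, 1 ≤ n ∧ n ≤ 5 ∧
      ∃ a : K, a ≠ 0 ∧ Matrix.trace g.1 = a + a⁻¹ ∧ a ^ (2 * n) = 1) ∨
    ∃ k : ℕ, p ^ k * ((p ^ k - 1) * (p ^ k + 1)) ≤ Nat.card Γ ∧ k ≠ 0 ∧
      ∀ g ∈ Γ, Matrix.trace g.1 ^ p ^ k = Matrix.trace g.1 ∨
        Matrix.trace g.1 ^ p ^ k = -Matrix.trace g.1 := by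
  classical
  have : Fintype (ℙ K (Fin 2 → K)) := Fintype.ofFinite _
  have : Fintype (orbitRel.Quotient Γ (ℙ K (Fin 2 → K))) := Fintype.ofFinite _
  have h2 : (2 : K) ≠ 0 := Ring.two_ne_zero (by rw [ringChar.eq K p]; omega)
  have hodd : p % 2 = 1 :=
    Nat.odd_iff.1 ((Fact.out : p.Prime).odd_of_ne_two (by omega))
  choose m n hn hmn hb hm hmf hfix using fun x =>
    stabilizer_structure p (by omega) Γ hneg x (le_trans (by norm_num) (horb x))
  have horbst : ∀ x : ℙ K (Fin 2 → K), Nat.card (orbit Γ x) * (2 * m x * n x) = Nat.card Γ :=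
    fun x => by
      rw [← hmn, ← Nat.card_prod]
      exact Nat.card_congr (orbitProdStabilizerEquivGroup Γ x)
  have hm1 : ∀ x, 1 ≤ m x := fun x => by
    obtain ⟨k, hk⟩ := hm x
    rw [hk]; exact Nat.one_le_pow _ _ (by omega)
  have hminv : ∀ (g : Γ) x, m (g • x) = m x := fun g x => by
    have := card_fixing_trace_smul Γ g x
    rw [hb, hb] at this
    omega
  have hninv : ∀ (g : Γ) x, n (g • x) = n x := fun g x => by
    have h1 := horbst x
    have h1' := horbst (g • x)
    rw [← h1, orbit_smul, hminv] at h1'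
    have := Nat.eq_of_mul_eq_mul_left (by have := horb x; omega) h1'
    exact Nat.eq_of_mul_eq_mul_left (by have := hm1 x; omega) this
  have hout : ∀ x : ℙ K (Fin 2 → K), ∃ ω : orbitRel.Quotient Γ (ℙ K (Fin 2 → K)),
      m x = m ω.out ∧ n x = n ω.out := fun x => by
    have : x ∈ orbit Γ (Quotient.mk'' x : orbitRel.Quotient Γ (ℙ K (Fin 2 → K))).out := by
      rw [← orbitRel_apply, ← Quotient.eq'', Quotient.out_eq']
    obtain ⟨g, hg⟩ := this
    refine ⟨Quotient.mk'' x, ?_, ?_⟩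
    · conv_lhs => rw [← hg]
      exact hminv g _
    · conv_lhs => rw [← hg]
      exact hninv g _
  obtain ⟨N, hN⟩ : ∃ N, Nat.card Γ = 2 * N := by
    have := horbst (pointAtInfty K)
    exact ⟨Nat.card (orbit Γ (pointAtInfty K)) * (m (pointAtInfty K) * n (pointAtInfty K)),
      by rw [← this]; ring⟩
  have hN' : ∀ x, m x * n x * Nat.card (orbit Γ x) = N := fun x => by
    have := horbst x
    rw [hN] at this
    have e : 2 * (m x * n x * Nat.card (orbit Γ x)) = 2 * N := by rw [← this]; ring
    omega
  have hNpos : 0 < N := by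
    have : 0 < Nat.card Γ := Nat.card_pos
    omega
  have hsum := sum_card_stabilizer_add h2 Γ hneg htr
  have hF : ∑ ω : orbitRel.Quotient Γ (ℙ K (Fin 2 → K)),
      (1 + 1 / (n ω.out : ℚ) - 2 / (m ω.out * n ω.out)) = 2 - 2 / N := by
    rw [Finset.sum_congr rfl (g := fun x => 2 * (m x : ℚ) * n x + 2 * m x - 4)
      (fun x _ => by rw [hmn, hb]; push_cast; ring),
      MulAction.sum_eq_sum_orbits (G := Γ) _ (fun g x => by rw [hminv, hninv]), hN] at hsum
    have hNq : (N : ℚ) ≠ 0 := by exact_mod_cast hNpos.ne'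
    have e : ∀ ω : orbitRel.Quotient Γ (ℙ K (Fin 2 → K)),
        (1 + 1 / (n ω.out : ℚ) - 2 / (m ω.out * n ω.out)) =
        (Nat.card (orbit Γ ω.out) : ℚ) * (2 * (m ω.out : ℚ) * n ω.out + 2 * m ω.out - 4) /
          (2 * N) := fun ω => by
      have hmq : (m ω.out : ℚ) ≠ 0 := by have := hm1 ω.out; exact_mod_cast (by omega)
      have hnq : (n ω.out : ℚ) ≠ 0 := by have := hn ω.out; exact_mod_cast (by omega)
      have hfq : (Nat.card (orbit Γ ω.out) : ℚ) ≠ 0 := by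
        have := horb ω.out; exact_mod_cast (by omega)
      rw [← hN' ω.out]
      push_cast
      field_simp
      ring
    rw [Finset.sum_congr rfl fun ω _ => e ω, ← Finset.sum_div, hsum]
    push_cast
    field_simp
    ring
  by_cases hall : ∀ x, m x = 1
  · left
    intro g hg
    obtain ⟨a, ha, hta⟩ := htr g hg
    obtain ⟨x, hx⟩ := exists_fixed_point ha hta
    refine ⟨n x, hn x, ?_, hfix x ⟨g, hg⟩ hx⟩
    obtain ⟨ω, -, hω⟩ := hout x
    rw [hω]
    refine orbit_count_coprime (fun ω : orbitRel.Quotient Γ (ℙ K (Fin 2 → K)) => n ω.out)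
      (fun ω => Nat.card (orbit Γ ω.out)) N (fun ω => hn _) (fun ω => horb _)
      (fun ω => by have := hN' ω.out; rwa [hall, one_mul] at this) ?_ ω
    rw [← hF]
    refine Finset.sum_congr rfl fun ω _ => ?_
    rw [hall]
    have hnq : (n ω.out : ℚ) ≠ 0 := by have := hn ω.out; exact_mod_cast (by omega)
    push_cast
    field_simp
    ring
  · right
    push Not at hall
    obtain ⟨x₀, hx₀⟩ := hall
    obtain ⟨ω₀, hω₀, -⟩ := hout x₀
    have key := orbit_count_modular
      (fun ω : orbitRel.Quotient Γ (ℙ K (Fin 2 → K)) => m ω.out)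
      (fun ω => n ω.out) (fun ω => Nat.card (orbit Γ ω.out)) N (fun ω => ?_)
      (fun ω => hn _) (fun ω => hN' _) hF ω₀ (hω₀ ▸ hx₀)
    · obtain ⟨hf, hdvd, hall⟩ := key
      obtain ⟨k, hk⟩ := hm ω₀.out
      have hk0 : k ≠ 0 := by
        rintro rfl
        exact hx₀ (by rw [hω₀, hk, pow_zero])
      refine ⟨k, ?_, hk0, ?_⟩
      · have h1 := horbst ω₀.out
        rw [hf] at h1
        have hle := Nat.le_of_dvd (by have := hn ω₀.out; omega) hdvd
        rw [← hk, ← h1]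
        calc m ω₀.out * ((m ω₀.out - 1) * (m ω₀.out + 1))
            ≤ m ω₀.out * ((2 * n ω₀.out) * (m ω₀.out + 1)) := by gcongr
          _ = _ := by ring
      · intro g hg
        obtain ⟨a, ha, hta⟩ := htr g hg
        obtain ⟨x, hx⟩ := exists_fixed_point ha hta
        obtain ⟨b, hb0, htb, hbn⟩ := hfix x ⟨g, hg⟩ hx
        obtain ⟨ω, -, hω⟩ := hout x
        have := hall ω
        rw [← hω, hk] at this
        have htb : Matrix.trace g.1 = b + b⁻¹ := htb
        rw [htb]
        exact trace_pow_of_pow_eq_one p hb0 hbn this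
    · by_cases h : m ω.out = 1
      · exact Or.inl h
      · right
        obtain ⟨k, hk⟩ := hm ω.out
        have hk0 : k ≠ 0 := by
          rintro rfl
          exact h (by rw [hk, pow_zero])
        refine ⟨?_, ?_, hmf _ h⟩
        · rw [hk]
          exact hp.trans (Nat.le_self_pow hk0 p)
        · exact Nat.odd_iff.1 (hk ▸ (Nat.odd_iff.2 hodd).pow)

end Matrix.SpecialLinearGroup

section FieldFacts

variable {p : ℕ} [Fact p.Prime]

theorem five_pow_half_eq_neg_one (hp : p ≠ 2) (h5 : p % 5 = 2 ∨ p % 5 = 3) (F : Type*) [Field F]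
    [CharP F p] : (5 : F) ^ (p / 2) = -1 := by
  have e2 : ¬ IsSquare ((2 : ℤ) : ZMod 5) := by decide
  have e3 : ¬ IsSquare ((3 : ℤ) : ZMod 5) := by decide
  have : Fact (Nat.Prime 5) := ⟨by norm_num⟩
  have h1 : legendreSym p ((5 : ℕ) : ℤ) = -1 := by
    rw [legendreSym.quadratic_reciprocity_one_mod_four (by norm_num) hp, legendreSym.mod]
    rcases h5 with h | h
    · have : ((p : ℤ) % ((5 : ℕ) : ℤ)) = 2 := by omega
      rw [this]; exact (legendreSym.eq_neg_one_iff 5).2 e2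
    · have : ((p : ℤ) % ((5 : ℕ) : ℤ)) = 3 := by omega
      rw [this]; exact (legendreSym.eq_neg_one_iff 5).2 e3
  have h2 := legendreSym.eq_pow p ((5 : ℕ) : ℤ)
  rw [h1] at h2
  have h3 := congrArg (ZMod.castHom (dvd_refl p) F) h2
  rw [map_pow, map_intCast, map_intCast] at h3
  push_cast at h3
  exact h3.symm

theorem pow_char_eq_of_sq_eq_self_add_one (hp : p ≠ 2) (h5 : p % 5 = 2 ∨ p % 5 = 3) {F : Type*}
    [Field F] [CharP F p] {τ : F} (hτ : τ ^ 2 = τ + 1) : τ ^ p = 1 - τ := by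
  have h2 : (2 : F) ≠ 0 := Ring.two_ne_zero (by rwa [ringChar.eq F p])
  have hodd : 2 * (p / 2) + 1 = p := by
    have := Nat.odd_iff.1 ((Fact.out : p.Prime).odd_of_ne_two hp)
    omega
  have h1 : (2 * τ - 1) ^ p = -(2 * τ - 1) := by
    conv_lhs => rw [← hodd, pow_succ, pow_mul, show (2 * τ - 1) ^ 2 = 5 by linear_combination 4 * hτ,
      five_pow_half_eq_neg_one hp h5]
    ring
  have h3 : (2 : F) ^ p = 2 := by
    have := map_ofNat (frobenius F p) 2
    rwa [frobenius_def] at this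
  rw [sub_pow_char, mul_pow, one_pow, h3] at h1
  exact mul_left_cancel₀ h2 (by linear_combination h1)

theorem four_dvd_of_pow_char_pow_eq {F : Type*} [Field F] [CharP F p] {z : F}
    (hz : z ^ p ^ 2 = 1 - z) (h2z : 2 * z ≠ 1) {k : ℕ} (hk : z ^ p ^ k = z ∨ z ^ p ^ k = -z)
    (hp : p ≠ 2) : 4 ∣ k := by
  have hodd := (Fact.out : p.Prime).odd_of_ne_two hp
  have hne : 1 - z ≠ z := fun h => h2z (by linear_combination -h)
  have hit : ∀ j, (Even j → z ^ p ^ (2 * j) = z) ∧ (¬ Even j → z ^ p ^ (2 * j) = 1 - z) := by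
    intro j
    induction j with
    | zero => simp
    | succ j ih =>
      have e : z ^ p ^ (2 * (j + 1)) = (z ^ p ^ (2 * j)) ^ p ^ 2 := by
        rw [← pow_mul, ← pow_add]; rfl
      rw [e, Nat.even_add_one, not_not]
      constructor
      · intro h
        rw [ih.2 h, sub_pow_char_pow, hz, one_pow]; ring
      · intro h
        rw [ih.1 h, hz]
  have h2k : z ^ p ^ (2 * k) = z := by
    rw [two_mul, pow_add, pow_mul]
    rcases hk with h | h
    · rw [h, h]
    · rw [h, (hodd.pow).neg_pow, h, neg_neg]
  have hke : Even k := by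
    by_contra h
    exact hne (((hit k).2 h).symm.trans h2k)
  obtain ⟨j, rfl⟩ := hke
  have hj : Even j := by
    by_contra h
    have := (hit j).2 h
    rw [two_mul] at this
    rcases hk with h | h
    · exact hne (this.symm.trans h)
    · exact one_ne_zero (by linear_combination h - this)
  obtain ⟨i, rfl⟩ := hj
  exact ⟨i, by ring⟩

theorem false_of_small_order (hp : p ≠ 2) (h5 : p % 5 = 2 ∨ p % 5 = 3) {F : Type*} [Field F]
    [CharP F p] {z a : F} (hz : z ^ p ^ 2 = 1 - z) (h2z : 2 * z ≠ 1) (ha : a ≠ 0)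
    (hza : z = a + a⁻¹) {n : ℕ} (hn : 1 ≤ n) (hn5 : n ≤ 5) (han : a ^ (2 * n) = 1) : False := by
  have key : ∀ k : ℕ, 0 < k → k < 4 → (z ^ 2) ^ p ^ k = z ^ 2 → False := by
    intro k hk hk4 h
    rw [← pow_mul, mul_comm, pow_mul, sq_eq_sq_iff_eq_or_eq_neg] at h
    have := four_dvd_of_pow_char_pow_eq hz h2z h hp
    omega
  have hnat : ∀ m : ℕ, z ^ 2 ≠ m := fun m hm => by
    refine key 1 one_pos (by norm_num) ?_
    rw [hm, pow_one]
    have := map_natCast (frobenius F p) m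
    rwa [frobenius_def] at this
  have hz2 : z ^ 2 = a ^ 2 + (a ^ 2)⁻¹ + 2 := by rw [hza]; field_simp; ring
  have hb0 : a ^ 2 ≠ 0 := pow_ne_zero 2 ha
  rw [pow_mul] at han
  generalize a ^ 2 = b at *
  have h1 : b ≠ 1 := fun h => hnat 4 (by rw [hz2, h]; norm_num)
  have hm1 : b ≠ -1 := fun h => hnat 0 (by rw [hz2, h]; norm_num)
  interval_cases n
  · exact h1 (by simpa using han)
  · rcases sq_eq_one_iff.1 han with h | h
    · exact h1 h
    · exact hm1 h
  · have h : (b - 1) * (b ^ 2 + b + 1) = 0 := by linear_combination han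
    have h := (mul_eq_zero.1 h).resolve_left (sub_ne_zero.2 h1)
    refine hnat 1 ?_
    rw [hz2]; field_simp; push_cast; linear_combination h
  · have h : (b - 1) * (b + 1) * (b ^ 2 + 1) = 0 := by linear_combination han
    have h := (mul_eq_zero.1 h).resolve_left
      (mul_ne_zero (sub_ne_zero.2 h1) fun h => hm1 (by linear_combination h))
    refine hnat 2 ?_
    rw [hz2]; field_simp; push_cast; linear_combination h
  · have h : (b - 1) * (b ^ 4 + b ^ 3 + b ^ 2 + b + 1) = 0 := by linear_combination han
    have h := (mul_eq_zero.1 h).resolve_left (sub_ne_zero.2 h1)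
    have hτ : (2 - z ^ 2) ^ 2 = (2 - z ^ 2) + 1 := by
      rw [hz2]; field_simp; linear_combination h
    have h3 := pow_char_eq_of_sq_eq_self_add_one hp h5 hτ
    have h4 : (1 - (2 - z ^ 2)) ^ p = 2 - z ^ 2 := by
      rw [sub_pow_char, h3, one_pow]; ring
    rw [← h3, ← pow_mul, ← pow_two] at h4
    have h6 : (2 : F) ^ p ^ 2 = 2 := by
      have := map_ofNat (iterateFrobenius F p 2) 2
      rwa [iterateFrobenius_def] at this
    rw [sub_pow_char_pow, h6] at h4
    exact key 2 two_pos (by norm_num) (by linear_combination -h4)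

/-- The roots of `z ^ 2 = z + 1 - τ` are distinct and interchanged by the `p ^ 2`-power Frobenius. -/
theorem pow_char_sq_eq (hp : p ≠ 2) {F : Type*} [Field F] [CharP F p]
    (ι : GaloisField p 2 →+* F) {s : GaloisField p 2} (hs : s ^ 2 = 5)
    (hns : ¬ IsSquare (3 + 2 * s) ∧ ¬ IsSquare (3 - 2 * s)) {τ z : F} (hτ : τ ^ 2 = τ + 1)
    (hz : z ^ 2 = z + 1 - τ) : z ^ p ^ 2 = 1 - z ∧ 2 * z ≠ 1 := by
  have : Fintype (GaloisField p 2) := Fintype.ofFinite _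
  have h2 : (2 : F) ≠ 0 := Ring.two_ne_zero (by rwa [ringChar.eq F p])
  have hodd : 2 * (p ^ 2 / 2) + 1 = p ^ 2 := by
    have := Nat.odd_iff.1 (((Fact.out : p.Prime).odd_of_ne_two hp).pow (n := 2))
    omega
  have hcard : Fintype.card (GaloisField p 2) = p ^ 2 := by
    rw [← Nat.card_eq_fintype_card, GaloisField.card p 2 two_ne_zero]
  have hb : ∃ b : GaloisField p 2, (2 * z - 1) ^ 2 = ι b ∧ ¬ IsSquare b := by
    have h : (2 * τ - 1 - ι s) * (2 * τ - 1 + ι s) = 0 := by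
      have := congrArg ι hs
      rw [map_pow, map_ofNat] at this
      linear_combination 4 * hτ - this
    rcases mul_eq_zero.1 h with h | h
    · refine ⟨3 - 2 * s, ?_, hns.2⟩
      simp only [map_sub, map_mul, map_ofNat]
      linear_combination 4 * hz - 2 * h
    · refine ⟨3 + 2 * s, ?_, hns.1⟩
      simp only [map_add, map_mul, map_ofNat]
      linear_combination 4 * hz - 2 * h
  obtain ⟨b, hb, hbs⟩ := hb
  have hb0 : b ≠ 0 := fun h => hbs (by rw [h]; exact ⟨0, by simp⟩)
  have hrc : ringChar (GaloisField p 2) ≠ 2 := by rwa [ringChar.eq _ p]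
  have hpow : b ^ (p ^ 2 / 2) = -1 := by
    have h1 := FiniteField.pow_dichotomy hrc hb0
    have h3 := FiniteField.isSquare_iff hrc hb0
    rw [hcard] at h1 h3
    exact h1.resolve_left fun h => hbs (h3.2 h)
  have h1 : (2 * z - 1) ^ p ^ 2 = -(2 * z - 1) := by
    conv_lhs => rw [← hodd, pow_succ, pow_mul, hb, ← map_pow, hpow]
    simp
  have h3 : (2 : F) ^ p ^ 2 = 2 := by
    have := map_ofNat (iterateFrobenius F p 2) 2
    rwa [iterateFrobenius_def] at this
  constructor
  · rw [sub_pow_char_pow, mul_pow, one_pow, h3] at h1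
    exact mul_left_cancel₀ h2 (by linear_combination h1)
  · intro h
    rw [h, sub_self, zero_pow two_ne_zero] at hb
    exact hb0 ((map_eq_zero ι).1 hb.symm)

theorem isSquare_map_of_card (hp : p ≠ 2) {F : Type*} [Field F] [CharP F p]
    [Fintype F] (hF : Fintype.card F = p ^ 4) (ι : GaloisField p 2 →+* F) (b : GaloisField p 2) :
    IsSquare (ι b) := by
  by_cases hb : b = 0
  · rw [hb, map_zero]; exact ⟨0, by simp⟩
  have : Fintype (GaloisField p 2) := Fintype.ofFinite _
  rw [FiniteField.isSquare_iff (by rwa [ringChar.eq _ p]) ((map_ne_zero ι).2 hb), hF]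
  have h1 := FiniteField.pow_card_sub_one_eq_one b hb
  rw [← Nat.card_eq_fintype_card, GaloisField.card p 2 two_ne_zero] at h1
  obtain ⟨c, hc⟩ := ((Fact.out : p.Prime).odd_of_ne_two hp).pow (n := 2)
  have : p ^ 4 / 2 = (p ^ 2 - 1) * (c + 1) := by
    have : p ^ 4 = 2 * ((p ^ 2 - 1) * (c + 1)) + 1 := by
      rw [show 4 = 2 * 2 from rfl, pow_mul, hc, Nat.add_sub_cancel]; ring
    omega
  rw [← map_pow, this, pow_mul, h1, one_pow, map_one]

theorem exists_golden_data (hp : p ≠ 2) {F : Type*} [Field F] [CharP F p]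
    [Fintype F] (hF : Fintype.card F = p ^ 4) (ι : GaloisField p 2 →+* F)
    {s : GaloisField p 2} (hs : s ^ 2 = 5) :
    ∃ τ z i : F, τ ^ 2 = τ + 1 ∧ z ^ 2 = z + 1 - τ ∧ i ^ 2 = -1 := by
  have h2 : (2 : F) ≠ 0 := Ring.two_ne_zero (by rwa [ringChar.eq F p])
  obtain ⟨i, hi⟩ := isSquare_map_of_card hp hF ι (-1)
  obtain ⟨d, hd⟩ := isSquare_map_of_card hp hF ι (3 - 2 * s)
  simp only [map_sub, map_mul, map_ofNat] at hd
  have := congrArg ι hs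
  rw [map_pow, map_ofNat] at this
  refine ⟨(1 + ι s) / 2, (1 + d) / 2, i, ?_, ?_, ?_⟩
  · field_simp; linear_combination this
  · field_simp; linear_combination -hd
  · rw [pow_two, ← hi]; simp

theorem seven_le_of_not_isSquare (hp : p ≠ 2) (h5 : p % 5 = 2 ∨ p % 5 = 3)
    {s : GaloisField p 2} (hs : s ^ 2 = 5) (hns : ¬ IsSquare (3 + 2 * s)) : 7 ≤ p := by
  have h3 : p ≠ 3 := by
    rintro rfl
    have : (3 : GaloisField 3 2) = 0 := by exact_mod_cast CharP.cast_eq_zero (GaloisField 3 2) 3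
    exact hns ⟨1 + s, by linear_combination -hs - this⟩
  have := (Fact.out : p.Prime).two_le
  omega

theorem exists_ringHom_map_eq (hp : p ≠ 2) (h5 : p % 5 = 2 ∨ p % 5 = 3) {F : Type*} [Field F]
    [CharP F p] (hpow : ∀ τ z : F, τ ^ 2 = τ + 1 → z ^ 2 = z + 1 - τ → z ^ p ^ 2 = 1 - z)
    {τ₁ z₁ τ₂ z₂ : F} (hτ₁ : τ₁ ^ 2 = τ₁ + 1) (hz₁ : z₁ ^ 2 = z₁ + 1 - τ₁)
    (hτ₂ : τ₂ ^ 2 = τ₂ + 1) (hz₂ : z₂ ^ 2 = z₂ + 1 - τ₂) :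
    ∃ φ : F →+* F, φ τ₁ = τ₂ ∧ φ z₁ = z₂ := by
  have h1 : ∃ φ : F →+* F, φ τ₁ = τ₂ := by
    have h : (τ₁ - τ₂) * (1 - τ₁ - τ₂) = 0 := by linear_combination hτ₂ - hτ₁
    rcases mul_eq_zero.1 h with h | h
    · exact ⟨RingHom.id F, sub_eq_zero.1 h⟩
    · refine ⟨frobenius F p, ?_⟩
      rw [frobenius_def, pow_char_eq_of_sq_eq_self_add_one hp h5 hτ₁, sub_eq_zero.1 h]
  obtain ⟨φ, hφ⟩ := h1
  have hφz : φ z₁ ^ 2 = φ z₁ + 1 - τ₂ := by rw [← map_pow, hz₁]; simp [hφ]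
  have h : (φ z₁ - z₂) * (1 - φ z₁ - z₂) = 0 := by linear_combination hz₂ - hφz
  rcases mul_eq_zero.1 h with h | h
  · exact ⟨φ, hφ, sub_eq_zero.1 h⟩
  · refine ⟨(iterateFrobenius F p 2).comp φ, ?_, ?_⟩
    · rw [RingHom.comp_apply, hφ, iterateFrobenius_def, pow_two, pow_mul,
        pow_char_eq_of_sq_eq_self_add_one hp h5 hτ₂, sub_pow_char, one_pow,
        pow_char_eq_of_sq_eq_self_add_one hp h5 hτ₂]
      ring
    · rw [RingHom.comp_apply, iterateFrobenius_def, hpow _ _ hτ₂ hφz, sub_eq_zero.1 h]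

end FieldFacts

namespace Matrix.SpecialLinearGroup

variable {F : Type*} [Field F]

theorem neg_one_mem_center : (-1 : SL(2, F)) ∈ Subgroup.center SL(2, F) := by
  rw [Subgroup.mem_center_iff]; intro g; simp

theorem mem_center_iff_eq_one_or_neg_one {g : SL(2, F)} :
    g ∈ Subgroup.center SL(2, F) ↔ g = 1 ∨ g = -1 := by
  constructor
  · intro h
    obtain ⟨r, -, hr⟩ := mem_center_iff.1 h
    have e : ∀ a b, g a b = Matrix.scalar (Fin 2) r a b := fun a b => by rw [hr]
    exact eq_one_or_neg_one_of_entries (by rw [e]; simp) (by rw [e]; simp) (by rw [e, e]; simp)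
  · rintro (rfl | rfl)
    · exact one_mem _
    · exact neg_one_mem_center

theorem coe_sq_eq (g : SL(2, F)) : g.1 ^ 2 = Matrix.trace g.1 • g.1 - 1 := by
  have hd := det_fin_two_eq g
  ext i j
  fin_cases i <;> fin_cases j <;>
    simp [pow_two, Matrix.mul_apply, Matrix.trace_fin_two, Fin.sum_univ_two]
  · linear_combination -hd
  · ring
  · ring
  · linear_combination -hd

theorem coe_pow_three_eq (g : SL(2, F)) :
    g.1 ^ 3 = (Matrix.trace g.1 ^ 2 - 1) • g.1 - Matrix.trace g.1 • (1 : Matrix (Fin 2) (Fin 2) F) := by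
  rw [pow_succ, coe_sq_eq, sub_mul, smul_mul_assoc, ← pow_two, coe_sq_eq, one_mul]
  module

theorem coe_pow_five_eq (g : SL(2, F)) :
    g.1 ^ 5 = (Matrix.trace g.1 ^ 4 - 3 * Matrix.trace g.1 ^ 2 + 1) • g.1 -
      (Matrix.trace g.1 ^ 3 - 2 * Matrix.trace g.1) • (1 : Matrix (Fin 2) (Fin 2) F) := by
  rw [show 5 = 3 + 2 from rfl, pow_add, coe_pow_three_eq, coe_sq_eq]
  generalize ht : Matrix.trace g.1 = t
  rw [mul_sub, sub_mul, smul_mul_smul_comm, ← pow_two, coe_sq_eq, ht, mul_one, smul_mul_assoc, one_mul]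
  module

theorem pow_three_eq_neg_one {g : SL(2, F)} (h : Matrix.trace g.1 = 1) : g ^ 3 = -1 :=
  Subtype.ext (by rw [coe_pow, coe_pow_three_eq, h]; simp)

theorem sq_eq_neg_one {g : SL(2, F)} (h : Matrix.trace g.1 = 0) : g ^ 2 = -1 :=
  Subtype.ext (by rw [coe_pow, coe_sq_eq, h]; simp)

theorem pow_five_eq_neg_one {g : SL(2, F)}
    (h : Matrix.trace g.1 ^ 2 = Matrix.trace g.1 + 1) : g ^ 5 = -1 :=
  Subtype.ext (by
    rw [coe_pow, coe_pow_five_eq,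
      show Matrix.trace g.1 ^ 4 - 3 * Matrix.trace g.1 ^ 2 + 1 = 0 by
        linear_combination (Matrix.trace g.1 ^ 2 + Matrix.trace g.1 - 1) * h,
      show Matrix.trace g.1 ^ 3 - 2 * Matrix.trace g.1 = 1 by
        linear_combination (Matrix.trace g.1 + 1) * h]
    simp)

theorem eq_zero_of_smul_sub_smul {g h : SL(2, F)} (hg : g ∉ Subgroup.center SL(2, F))
    (hh : h ∈ Subgroup.center SL(2, F)) {c d : F}
    (e : h.1 = c • g.1 - d • (1 : Matrix (Fin 2) (Fin 2) F)) : c = 0 := by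
  by_contra hc
  obtain ⟨r, -, hr⟩ := mem_center_iff.1 hh
  rw [← hr] at e
  refine hg (mem_center_iff_eq_one_or_neg_one.2 (eq_one_or_neg_one_of_entries ?_ ?_ ?_))
  · have := congrFun (congrFun e 1) 0
    simpa [hc] using this
  · have := congrFun (congrFun e 0) 1
    simpa [hc] using this
  · have h0 := congrFun (congrFun e 0) 0
    have h1 := congrFun (congrFun e 1) 1
    simp at h0 h1
    exact mul_left_cancel₀ hc (by linear_combination h1 - h0)

theorem trace_of_pow_three_mem_center {g : SL(2, F)} (hg : g ∉ Subgroup.center SL(2, F))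
    (h : g ^ 3 ∈ Subgroup.center SL(2, F)) : Matrix.trace g.1 = 1 ∨ Matrix.trace g.1 = -1 := by
  have := eq_zero_of_smul_sub_smul hg h ((coe_pow g 3).trans (coe_pow_three_eq g))
  exact sq_eq_one_iff.1 (sub_eq_zero.1 this)

theorem trace_of_sq_mem_center {g : SL(2, F)} (hg : g ∉ Subgroup.center SL(2, F))
    (h : g ^ 2 ∈ Subgroup.center SL(2, F)) : Matrix.trace g.1 = 0 :=
  eq_zero_of_smul_sub_smul hg h (d := 1) ((coe_pow g 2).trans ((coe_sq_eq g).trans (by simp)))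

theorem trace_of_pow_five_mem_center {g : SL(2, F)} (hg : g ∉ Subgroup.center SL(2, F))
    (h : g ^ 5 ∈ Subgroup.center SL(2, F)) :
    Matrix.trace g.1 ^ 2 = Matrix.trace g.1 + 1 ∨
      (-Matrix.trace g.1) ^ 2 = -Matrix.trace g.1 + 1 := by
  have := eq_zero_of_smul_sub_smul hg h ((coe_pow g 5).trans (coe_pow_five_eq g))
  have : (Matrix.trace g.1 ^ 2 - Matrix.trace g.1 - 1) *
      (Matrix.trace g.1 ^ 2 + Matrix.trace g.1 - 1) = 0 := by linear_combination this
  rcases mul_eq_zero.1 this with h | h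
  · left; linear_combination h
  · right; linear_combination h

/-- Lifts to `SL(2, F)` of generators of a quotient of the tetrahedral group, normalized by sign,
with `τ` the trace of the second one and `z` the trace of the product of the other two. -/
structure IsTetTriple (A B C : SL(2, F)) (τ z : F) : Prop where
  trace_A : Matrix.trace A.1 = 1
  trace_C : Matrix.trace C.1 = 1
  trace_B : Matrix.trace B.1 = τ
  golden : τ ^ 2 = τ + 1
  trace_AB : Matrix.trace (A * B).1 = 0
  trace_BC : Matrix.trace (B * C).1 = 0
  trace_ABC : Matrix.trace (A * B * C).1 = 0
  trace_AC : Matrix.trace (A * C).1 = z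

theorem trace_map {K : Type*} [Field K] (φ : F →+* K) (g : SL(2, F)) :
    Matrix.trace (Matrix.SpecialLinearGroup.map φ g).1 = φ (Matrix.trace g.1) := by
  rw [Matrix.trace_fin_two, Matrix.trace_fin_two, map_add]; rfl

theorem IsTetTriple.map {K : Type*} [Field K] {A B C : SL(2, F)} {τ z : F}
    (h : IsTetTriple A B C τ z) (φ : F →+* K) :
    IsTetTriple (Matrix.SpecialLinearGroup.map φ A) (Matrix.SpecialLinearGroup.map φ B)
      (Matrix.SpecialLinearGroup.map φ C) (φ τ) (φ z) where
  trace_A := by rw [trace_map, h.trace_A, map_one]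
  trace_C := by rw [trace_map, h.trace_C, map_one]
  trace_B := by rw [trace_map, h.trace_B]
  golden := by rw [← map_pow, h.golden]; simp
  trace_AB := by rw [← map_mul, trace_map, h.trace_AB, map_zero]
  trace_BC := by rw [← map_mul, trace_map, h.trace_BC, map_zero]
  trace_ABC := by rw [← map_mul, ← map_mul, trace_map, h.trace_ABC, map_zero]
  trace_AC := by rw [← map_mul, trace_map, h.trace_AC]

/-- Normal form of the image of `αβγ`. -/
def normalG (i : F) : Matrix (Fin 2) (Fin 2) F := !![i, 0; 0, -i]

/-- Normal form of the image of `βγ`. -/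
def normalE (i : F) : Matrix (Fin 2) (Fin 2) F := !![i / 2, 1; -3 / 4, -(i / 2)]

/-- Normal form of the image of `αβ`. -/
def normalD (i τ z : F) : Matrix (Fin 2) (Fin 2) F :=
  !![i / 2, 2 / 3 * (z - 1 / 2 - i * τ); -(1 / 2) * (z - 1 / 2 + i * τ), -(i / 2)]

theorem exists_isTetTriple (h2 : (2 : F) ≠ 0) (h3 : (3 : F) ≠ 0) {i τ z : F} (hi : i ^ 2 = -1)
    (hτ : τ ^ 2 = τ + 1) (hz : z ^ 2 = z + 1 - τ) :
    ∃ A B C : SL(2, F), IsTetTriple A B C τ z := by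
  have h4 : (4 : F) ≠ 0 := by
    have := mul_ne_zero h2 h2; norm_num at this; exact this
  obtain ⟨G, hG'⟩ : ∃ G : SL(2, F), G.1 = normalG i := ⟨⟨normalG i, by
    simp [normalG, Matrix.det_fin_two]; linear_combination -hi⟩, rfl⟩
  obtain ⟨E, hE'⟩ : ∃ E : SL(2, F), E.1 = normalE i := ⟨⟨normalE i, by
    simp [normalE, Matrix.det_fin_two]; field_simp; linear_combination -4 * hi⟩, rfl⟩
  obtain ⟨D, hD'⟩ : ∃ D : SL(2, F), D.1 = normalD i τ z := ⟨⟨normalD i τ z, by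
    simp [normalD, Matrix.det_fin_two]; field_simp
    linear_combination (-3 - 4 * τ ^ 2) * hi + 4 * hz + 4 * hτ⟩, rfl⟩
  have hE : E ^ 2 = -1 := sq_eq_neg_one (by simp [hE', normalE])
  have hD : D ^ 2 = -1 := sq_eq_neg_one (by simp [hD', normalD])
  have hG : G ^ 2 = -1 := sq_eq_neg_one (by simp [hG', normalG])
  refine ⟨-(G * E), -(E * G * D), -(D * G), ?_⟩
  have e1 : -(G * E) * -(E * G * D) = D := by
    rw [neg_mul_neg, show G * E * (E * G * D) = G * E ^ 2 * G * D by simp only [pow_two, mul_assoc],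
      hE]
    simp [← pow_two, hG]
  have e2 : -(E * G * D) * -(D * G) = E := by
    rw [neg_mul_neg, show E * G * D * (D * G) = E * (G * D ^ 2 * G) by
      simp only [pow_two, mul_assoc], hD]
    simp [← pow_two, hG]
  have e3 : -(G * E) * -(E * G * D) * -(D * G) = G := by
    rw [e1, mul_neg, ← mul_assoc, ← pow_two, hD]; simp
  exact
    { trace_A := by
        rw [coe_neg, coe_mul, hG', hE']
        simp [normalG, normalE, Matrix.trace_fin_two]
        field_simp; linear_combination -2 * hi
      trace_C := by
        rw [coe_neg, coe_mul, hG', hD']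
        simp [normalG, normalD, Matrix.trace_fin_two]
        field_simp; linear_combination -2 * hi
      trace_B := by
        rw [coe_neg, coe_mul, coe_mul, hG', hE', hD']
        simp [normalG, normalD, normalE, Matrix.trace_fin_two]
        field_simp
        linear_combination -16 * τ * hi
      golden := hτ
      trace_AB := by rw [e1]; simp [hD', normalD]
      trace_BC := by rw [e2]; simp [hE', normalE]
      trace_ABC := by rw [e3]; simp [hG', normalG]
      trace_AC := by
        rw [neg_mul_neg, coe_mul, coe_mul, coe_mul, hG', hE', hD']
        simp [normalG, normalD, normalE, Matrix.trace_fin_two]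
        field_simp
        linear_combination (8 * i ^ 2 - 16 * z) * hi }


variable {F : Type*} [Field F]

theorem mul_add_mul_eq_trace_smul {X Y : Matrix (Fin 2) (Fin 2) F} (hX : X.trace = 0)
    (hY : Y.trace = 0) : X * Y + Y * X = (X * Y).trace • (1 : Matrix (Fin 2) (Fin 2) F) := by
  rw [Matrix.trace_fin_two] at hX hY
  ext i j
  fin_cases i <;> fin_cases j <;>
    simp [Matrix.mul_apply, Matrix.trace_fin_two, Fin.sum_univ_two]
  · linear_combination Y 0 0 * hX - X 1 1 * hY
  · linear_combination X 0 1 * hY + Y 0 1 * hX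
  · linear_combination X 1 0 * hY + Y 1 0 * hX
  · linear_combination X 1 1 * hY - Y 0 0 * hX

/-- Two traceless matrices `G`, `E` of determinant one with `tr (GE) = -1` are simultaneously
conjugate to their normal forms. -/
theorem exists_conj_normalG_normalE (h2 : (2 : F) ≠ 0) (h3 : (3 : F) ≠ 0) {i : F}
    (hi : i ^ 2 = -1) {G E : SL(2, F)} (hG : Matrix.trace G.1 = 0) (hE : Matrix.trace E.1 = 0)
    (hGE : Matrix.trace (G * E).1 = -1) :
    ∃ Q : GL (Fin 2) F, G.1 * Q.1 = Q.1 * normalG i ∧ E.1 * Q.1 = Q.1 * normalE i := by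
  have h4 : (4 : F) ≠ 0 := by
    have := mul_ne_zero h2 h2; norm_num at this; exact this
  have hi0 : i ≠ 0 := by rintro rfl; simp at hi
  have hE2 : E.1 * E.1 = -1 := by
    have := congrArg Subtype.val (sq_eq_neg_one hE); simpa [pow_two] using this
  have hanti : G.1 * E.1 + E.1 * G.1 = -1 := by
    rw [mul_add_mul_eq_trace_smul hG hE, ← coe_mul, hGE]; simp
  obtain ⟨v, hv, hv'⟩ : ∃ v, v ≠ 0 ∧ (G.1 - i • (1 : Matrix (Fin 2) (Fin 2) F)) *ᵥ v = 0 := by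
    rw [Matrix.exists_mulVec_eq_zero_iff, Matrix.det_fin_two]
    have := det_fin_two_eq G
    rw [Matrix.trace_fin_two] at hG
    simp
    linear_combination this + hi - i * hG
  have hGv : G.1 *ᵥ v = i • v := by
    rw [Matrix.sub_mulVec, Matrix.smul_mulVec, Matrix.one_mulVec, sub_eq_zero] at hv'
    exact hv'
  have hEEv : E.1 *ᵥ (E.1 *ᵥ v) = -v := by
    rw [Matrix.mulVec_mulVec, hE2, Matrix.neg_mulVec, Matrix.one_mulVec]
  have hGEv : G.1 *ᵥ (E.1 *ᵥ v) = -v - i • (E.1 *ᵥ v) := by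
    rw [Matrix.mulVec_mulVec, eq_sub_of_add_eq hanti, Matrix.sub_mulVec, Matrix.neg_mulVec,
      Matrix.one_mulVec, ← Matrix.mulVec_mulVec, hGv, Matrix.mulVec_smul]
  obtain ⟨w, hw⟩ : ∃ w, w = E.1 *ᵥ v := ⟨_, rfl⟩
  rw [← hw] at hEEv hGEv
  obtain ⟨u, hu⟩ : ∃ u, u = (-(4 / 3) : F) • (w - (i / 2) • v) := ⟨_, rfl⟩
  have hGu : G.1 *ᵥ u = (-i) • u := by
    rw [hu, Matrix.mulVec_smul, Matrix.mulVec_sub, Matrix.mulVec_smul, hGEv, hGv]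
    ext j; simp; field_simp
    linear_combination 2 * v j * hi
  have hEu : E.1 *ᵥ u = v - (i / 2) • u := by
    rw [hu, Matrix.mulVec_smul, Matrix.mulVec_sub, Matrix.mulVec_smul, hEEv, ← hw]
    ext j; simp; field_simp
    linear_combination 4 * v j * hi
  have hEv : E.1 *ᵥ v = (i / 2) • v - (3 / 4 : F) • u := by
    rw [← hw, hu]
    ext j; simp; field_simp
    ring
  have hu0 : u ≠ 0 := by
    rintro rfl
    simp at hEu; exact hv hEu.symm
  have hdet : IsUnit (Matrix.det !![v 0, u 0; v 1, u 1]) := by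
    rw [isUnit_iff_ne_zero]
    intro h0
    obtain ⟨c, hc, hc'⟩ := Matrix.exists_mulVec_eq_zero_iff.2 h0
    have e : c 0 • v + c 1 • u = 0 := by
      ext j
      have := congrFun hc' j
      fin_cases j <;> simp [Matrix.mulVec, dotProduct, Fin.sum_univ_two] at this ⊢ <;>
        linear_combination this
    have e' := congrArg (G.1 *ᵥ ·) e
    simp only [Matrix.mulVec_add, Matrix.mulVec_smul, hGv, hGu, Matrix.mulVec_zero] at e'
    have k0 : (c 0 * i * 2) • v = 0 := by linear_combination (norm := module) e' + i • e
    have k1 : (c 1 * i * 2) • u = 0 := by linear_combination (norm := module) i • e - e'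
    refine hc (funext fun j => ?_)
    fin_cases j
    · simpa [hv, hi0, h2] using k0
    · simpa [hu0, hi0, h2] using k1
  obtain ⟨Q, hQ⟩ : ∃ Q : GL (Fin 2) F, Q.1 = !![v 0, u 0; v 1, u 1] :=
    ⟨Matrix.GeneralLinearGroup.mk'' _ hdet, rfl⟩
  refine ⟨Q, ?_, ?_⟩ <;> rw [hQ]
  · ext a b
    have x := congrFun hGv a
    have y := congrFun hGu a
    fin_cases a <;> fin_cases b <;>
      simp [normalG, Matrix.mul_apply, Fin.sum_univ_two, Matrix.mulVec, dotProduct] at x y ⊢ <;>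
      first | linear_combination x | linear_combination y
  · ext a b
    have x := congrFun hEv a
    have y := congrFun hEu a
    fin_cases a <;> fin_cases b <;>
      simp [normalE, Matrix.mul_apply, Fin.sum_univ_two, Matrix.mulVec, dotProduct] at x y ⊢ <;>
      first | linear_combination x | linear_combination y

theorem eq_normalD (h2 : (2 : F) ≠ 0) (h3 : (3 : F) ≠ 0) {i τ z : F}
    (hi : i ^ 2 = -1) {X : Matrix (Fin 2) (Fin 2) F} (hX : X.trace = 0)
    (hG : (X * normalG i).trace = -1) (hE : (normalE i * X).trace = -z)
    (hEG : (normalE i * normalG i * X).trace = -τ) : X = normalD i τ z := by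
  have h4 : (4 : F) ≠ 0 := by
    have := mul_ne_zero h2 h2; norm_num at this; exact this
  simp [normalG, normalE, Matrix.trace_fin_two, Matrix.mul_apply, Fin.sum_univ_two,
      Matrix.vecMul, dotProduct]
    at hX hG hE hEG
  have h11 : X 1 1 = -X 0 0 := by linear_combination hX
  rw [h11] at hG hE hEG
  have h00 : 2 * X 0 0 = i := by linear_combination 2 * X 0 0 * hi - i * hG
  have hP : 4 * X 1 0 - 3 * X 0 1 = 2 - 4 * z := by
    field_simp at hE
    exact mul_left_cancel₀ h2 (by linear_combination hE - 4 * hG)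
  have hS : 4 * X 1 0 + 3 * X 0 1 = -4 * i * τ := by
    field_simp at hEG
    exact mul_left_cancel₀ h2 (by
      linear_combination i * hEG + (8 * X 1 0 + 6 * X 0 1) * hi)
  ext a b
  fin_cases a <;> fin_cases b <;> simp [normalD] <;> field_simp
  · linear_combination h00
  · exact mul_left_cancel₀ h2 (by linear_combination hS - hP)
  · exact mul_left_cancel₀ h2 (by linear_combination hS + hP)
  · linear_combination 2 * h11 - h00

/-- A normalized triple is determined up to conjugacy by its parameters, which satisfy a
quadratic relation. -/
theorem IsTetTriple.exists_conj (h2 : (2 : F) ≠ 0) (h3 : (3 : F) ≠ 0) {i τ z : F}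
    (hi : i ^ 2 = -1) {A B C : SL(2, F)} (h : IsTetTriple A B C τ z) :
    z ^ 2 = z + 1 - τ ∧ ∃ Q : GL (Fin 2) F,
      A.1 * Q.1 = Q.1 * -(normalG i * normalE i) ∧
      B.1 * Q.1 = Q.1 * -(normalE i * normalG i * normalD i τ z) ∧
      C.1 * Q.1 = Q.1 * -(normalD i τ z * normalG i) := by
  have hE := sq_eq_neg_one h.trace_BC
  have hD := sq_eq_neg_one h.trace_AB
  have hG := sq_eq_neg_one h.trace_ABC
  obtain ⟨E, hE'⟩ : ∃ E, E = B * C := ⟨_, rfl⟩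
  obtain ⟨D, hD'⟩ : ∃ D, D = A * B := ⟨_, rfl⟩
  obtain ⟨G, hG'⟩ : ∃ G, G = A * B * C := ⟨_, rfl⟩
  have tE := h.trace_BC
  have tD := h.trace_AB
  have tG := h.trace_ABC
  rw [← hE'] at hE tE
  rw [← hD'] at hD tD
  rw [← hG'] at hG tG
  have inv : ∀ {X : SL(2, F)}, X ^ 2 = -1 → X⁻¹ = -X := fun {X} hX => by
    rw [inv_eq_iff_mul_eq_one, mul_neg, ← pow_two, hX, neg_neg]
  have hA : A = -(G * E) := by
    rw [← mul_neg, ← inv hE, hG', hE']; group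
  have hC : C = -(D * G) := by
    rw [← neg_mul, ← inv hD, hG', hD']; group
  have hB : B = -(E * G * D) := by
    have : B = E * G⁻¹ * D := by rw [hE', hG', hD']; group
    rw [this, inv hG]; simp
  have tA := h.trace_A
  have tB := h.trace_B
  have tC := h.trace_C
  have tAC := h.trace_AC
  have neg_tr : ∀ X : SL(2, F), Matrix.trace (-X).1 = -Matrix.trace X.1 := fun X => by
    rw [coe_neg, Matrix.trace_neg]
  rw [hA, neg_tr, neg_eq_iff_eq_neg] at tA
  rw [hB, neg_tr, neg_eq_iff_eq_neg] at tB
  rw [hC, neg_tr, neg_eq_iff_eq_neg] at tC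
  have hAC : A * C = -(G * (E * D) * G⁻¹) := by
    rw [hA, hC, inv hG]; simp [mul_assoc]
  rw [hAC, neg_tr, neg_eq_iff_eq_neg, coe_mul, Matrix.trace_mul_comm, ← coe_mul,
    inv_mul_cancel_left] at tAC
  obtain ⟨Q, hQG, hQE⟩ := exists_conj_normalG_normalE h2 h3 hi tG tE tA
  have hQ1 : Q.1 * Q⁻¹.1 = 1 := by rw [← Units.val_mul]; simp
  have hQ2 : Q⁻¹.1 * Q.1 = 1 := by rw [← Units.val_mul]; simp
  have hQD : D.1 * Q.1 = Q.1 * (Q⁻¹.1 * D.1 * Q.1) := by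
    rw [← mul_assoc, ← mul_assoc, hQ1, one_mul]
  have conj_trace : ∀ X : Matrix (Fin 2) (Fin 2) F,
      (Q⁻¹.1 * X * Q.1).trace = X.trace := fun X => by
    rw [Matrix.trace_mul_comm, ← mul_assoc, hQ1, one_mul]
  have hnG : normalG i = Q⁻¹.1 * G.1 * Q.1 := by rw [mul_assoc, hQG, ← mul_assoc, hQ2, one_mul]
  have hnE : normalE i = Q⁻¹.1 * E.1 * Q.1 := by rw [mul_assoc, hQE, ← mul_assoc, hQ2, one_mul]
  have conj_mul : ∀ X Y : Matrix (Fin 2) (Fin 2) F,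
      Q⁻¹.1 * X * Q.1 * (Q⁻¹.1 * Y * Q.1) = Q⁻¹.1 * (X * Y) * Q.1 := fun X Y => by
    rw [show Q⁻¹.1 * X * Q.1 * (Q⁻¹.1 * Y * Q.1) = Q⁻¹.1 * X * (Q.1 * Q⁻¹.1) * Y * Q.1 by
      simp only [mul_assoc], hQ1]
    simp only [mul_assoc, one_mul]
  have key : Q⁻¹.1 * D.1 * Q.1 = normalD i τ z := by
    refine eq_normalD h2 h3 hi ?_ ?_ ?_ ?_
    · rw [conj_trace, tD]
    · rw [hnG, conj_mul, conj_trace, ← coe_mul, tC]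
    · rw [hnE, conj_mul, conj_trace, ← coe_mul, tAC]
    · rw [hnE, hnG, conj_mul, conj_mul, conj_trace, ← coe_mul, ← coe_mul, tB]
  rw [key] at hQD
  refine ⟨?_, Q, ?_, ?_, ?_⟩
  · have hdet : (normalD i τ z).det = 1 := by
      rw [← key, Matrix.det_mul, Matrix.det_mul, mul_right_comm, ← Matrix.det_mul, hQ2,
        Matrix.det_one, one_mul, D.2]
    have h4 : (4 : F) ≠ 0 := by
      have := mul_ne_zero h2 h2; norm_num at this; exact this
    simp [normalD, Matrix.det_fin_two] at hdet
    field_simp at hdet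
    exact mul_left_cancel₀ h4 (by linear_combination hdet + (3 + 4 * τ ^ 2) * hi - 4 * h.golden)
  · rw [hA, coe_neg, coe_mul, neg_mul, mul_neg, mul_assoc, hQE, ← mul_assoc, hQG, mul_assoc]
  · rw [hB, coe_neg, coe_mul, coe_mul, neg_mul, mul_neg, mul_assoc, hQD, ← mul_assoc,
      mul_assoc E.1, hQG, ← mul_assoc, hQE, mul_assoc, mul_assoc, mul_assoc]
  · rw [hC, coe_neg, coe_mul, neg_mul, mul_neg, mul_assoc, hQG, ← mul_assoc, hQD, mul_assoc]

end Matrix.SpecialLinearGroup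

theorem eq_one_of_pow_two_of_pow_three {G : Type*} [Group G] {a : G} (h2 : a ^ 2 = 1)
    (h3 : a ^ 3 = 1) : a = 1 := by
  rw [pow_succ, h2, one_mul] at h3; exact h3

theorem eq_one_of_pow_two_of_pow_five {G : Type*} [Group G] {a : G} (h2 : a ^ 2 = 1)
    (h5 : a ^ 5 = 1) : a = 1 := by
  rw [pow_succ, show 4 = 2 * 2 from rfl, pow_mul, h2, one_pow, one_mul] at h5; exact h5

theorem eq_one_of_pow_three_of_pow_five {G : Type*} [Group G] {a : G} (h3 : a ^ 3 = 1)
    (h5 : a ^ 5 = 1) : a = 1 :=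
  eq_one_of_pow_two_of_pow_three (by rwa [show 5 = 3 + 2 from rfl, pow_add, h3, one_mul] at h5) h3

/-- In a quotient of the tetrahedral group, if one of the torsion elements `α, β, γ, αβ, βγ, αβγ`
is trivial, then so are the generators. -/
theorem tet_collapse {G : Type*} [Group G] {a b c : G} (ha : a ^ 3 = 1) (hb : b ^ 5 = 1)
    (hc : c ^ 3 = 1) (hab : (a * b) ^ 2 = 1) (hbc : (b * c) ^ 2 = 1) (habc : (a * b * c) ^ 2 = 1)
    (h : a = 1 ∨ b = 1 ∨ c = 1 ∨ a * b = 1 ∨ b * c = 1 ∨ a * b * c = 1) :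
    a = 1 ∧ b = 1 ∧ c = 1 := by
  have hB : b = 1 → a = 1 ∧ b = 1 ∧ c = 1 := by
    rintro rfl
    rw [mul_one] at hab
    rw [one_mul] at hbc
    exact ⟨eq_one_of_pow_two_of_pow_three hab ha, rfl, eq_one_of_pow_two_of_pow_three hbc hc⟩
  have hA : a = 1 → a = 1 ∧ b = 1 ∧ c = 1 := by
    rintro rfl
    rw [one_mul] at hab
    exact hB (eq_one_of_pow_two_of_pow_five hab hb)
  rcases h with h | h | h | h | h | h
  · exact hA h
  · exact hB h
  · rw [h, mul_one] at hbc
    exact hB (eq_one_of_pow_two_of_pow_five hbc hb)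
  · rw [eq_inv_of_mul_eq_one_left h, inv_pow, inv_eq_one] at ha
    exact hB (eq_one_of_pow_three_of_pow_five ha hb)
  · rw [eq_inv_of_mul_eq_one_right h, inv_pow, inv_eq_one] at hc
    exact hB (eq_one_of_pow_three_of_pow_five hc hb)
  · rw [mul_assoc] at h
    rw [eq_inv_of_mul_eq_one_right h, inv_pow, inv_eq_one] at hbc
    exact hA (eq_one_of_pow_two_of_pow_three hbc ha)

theorem tet_relations {G : Type*} [Group G] (f : Tet →* G) :
    f (.of 0) ^ 3 = 1 ∧ f (.of 1) ^ 5 = 1 ∧ f (.of 2) ^ 3 = 1 ∧ (f (.of 0) * f (.of 1)) ^ 2 = 1 ∧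
      (f (.of 1) * f (.of 2)) ^ 2 = 1 ∧ (f (.of 0) * f (.of 1) * f (.of 2)) ^ 2 = 1 := by
  have key : ∀ r ∈ tetRelators, f (PresentedGroup.mk tetRelators r) = 1 := fun r hr => by
    rw [PresentedGroup.one_of_mem hr, map_one]
  have comp : ∀ r ∈ tetRelators, (f.comp (PresentedGroup.mk tetRelators)) r = 1 := key
  generalize hg : f.comp (PresentedGroup.mk tetRelators) = g at comp
  have hof : ∀ j, f (.of j) = g (.of j) := fun j => by rw [← hg]; rfl
  simp only [tetRelators, Set.mem_insert_iff, Set.mem_singleton_iff, forall_eq_or_imp, forall_eq,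
    map_pow, map_mul] at comp
  simpa only [hof] using comp

namespace Matrix.SpecialLinearGroup

variable {F : Type*} [Field F]

theorem mk_neg (g : SL(2, F)) : (QuotientGroup.mk (-g) : PSL(2, F)) = QuotientGroup.mk g := by
  rw [QuotientGroup.eq]
  have : (-g)⁻¹ * g = -1 := by
    rw [inv_mul_eq_iff_eq_mul]; simp
  rw [this]
  exact neg_one_mem_center

theorem pow_mem_center_of_mk_pow_eq_one {g : SL(2, F)} {n : ℕ}
    (h : (QuotientGroup.mk g : PSL(2, F)) ^ n = 1) : g ^ n ∈ Subgroup.center SL(2, F) := by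
  rwa [← QuotientGroup.mk_pow, QuotientGroup.eq_one_iff] at h

theorem exists_trace_eq_one {x : PSL(2, F)} (h1 : x ≠ 1) (h3 : x ^ 3 = 1) :
    ∃ g : SL(2, F), QuotientGroup.mk g = x ∧ Matrix.trace g.1 = 1 := by
  obtain ⟨g, rfl⟩ := QuotientGroup.mk_surjective x
  rcases trace_of_pow_three_mem_center (mt (QuotientGroup.eq_one_iff g).2 h1)
    (pow_mem_center_of_mk_pow_eq_one h3) with h | h
  · exact ⟨g, rfl, h⟩
  · exact ⟨-g, mk_neg g, by rw [coe_neg, Matrix.trace_neg, h, neg_neg]⟩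

theorem exists_trace_sq_eq {x : PSL(2, F)} (h1 : x ≠ 1) (h5 : x ^ 5 = 1) :
    ∃ g : SL(2, F), QuotientGroup.mk g = x ∧ Matrix.trace g.1 ^ 2 = Matrix.trace g.1 + 1 := by
  obtain ⟨g, rfl⟩ := QuotientGroup.mk_surjective x
  rcases trace_of_pow_five_mem_center (mt (QuotientGroup.eq_one_iff g).2 h1)
    (pow_mem_center_of_mk_pow_eq_one h5) with h | h
  · exact ⟨g, rfl, h⟩
  · exact ⟨-g, mk_neg g, by rw [coe_neg, Matrix.trace_neg, h]⟩

theorem trace_eq_zero_of_mk_sq {g : SL(2, F)} (h1 : (QuotientGroup.mk g : PSL(2, F)) ≠ 1)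
    (h2 : (QuotientGroup.mk g : PSL(2, F)) ^ 2 = 1) : Matrix.trace g.1 = 0 :=
  trace_of_sq_mem_center (mt (QuotientGroup.eq_one_iff g).2 h1)
    (pow_mem_center_of_mk_pow_eq_one h2)

instance : Nontrivial PSL(2, F) := by
  have hd : Matrix.det !![(1 : F), 1; 0, 1] = 1 := by simp
  refine ⟨⟨QuotientGroup.mk ⟨!![(1 : F), 1; 0, 1], hd⟩, 1, fun h => ?_⟩⟩
  have h := mem_center_iff_eq_one_or_neg_one.1 ((QuotientGroup.eq_one_iff _).1 h)
  rcases h with h | h <;>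
  · have := congrArg (fun g : SL(2, F) => g.1 0 1) h
    simp at this

/-- The generators of an epimorphic image `PSL(2, F)` of the tetrahedral group lift to a
normalized triple. -/
theorem exists_isTetTriple_of_surjective (f : Tet →* PSL(2, F)) (hf : Function.Surjective f) :
    ∃ A B C : SL(2, F), ∃ τ z, IsTetTriple A B C τ z ∧ f (.of 0) = QuotientGroup.mk A ∧
      f (.of 1) = QuotientGroup.mk B ∧ f (.of 2) = QuotientGroup.mk C := by
  obtain ⟨ha, hb, hc, hab, hbc, habc⟩ := tet_relations f
  have hne : ¬ (f (.of 0) = 1 ∧ f (.of 1) = 1 ∧ f (.of 2) = 1) := by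
    rintro ⟨h0, h1, h2⟩
    have : f = 1 := by
      refine PresentedGroup.ext fun j => ?_
      fin_cases j
      exacts [h0, h1, h2]
    obtain ⟨x, hx⟩ := exists_ne (1 : PSL(2, F))
    obtain ⟨y, rfl⟩ := hf x
    exact hx (by rw [this]; rfl)
  have hcol := mt (tet_collapse ha hb hc hab hbc habc) hne
  push Not at hcol
  obtain ⟨na, nb, nc, nab, nbc, nabc⟩ := hcol
  obtain ⟨A, hA, tA⟩ := exists_trace_eq_one na ha
  obtain ⟨B, hB, tB⟩ := exists_trace_sq_eq nb hb
  obtain ⟨C, hC, tC⟩ := exists_trace_eq_one nc hc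
  rw [← hA, ← hB] at hab nab
  rw [← hB, ← hC] at hbc nbc
  rw [← hA, ← hB, ← hC] at habc nabc
  exact ⟨A, B, C, _, _,
    { trace_A := tA
      trace_C := tC
      trace_B := rfl
      golden := tB
      trace_AB := trace_eq_zero_of_mk_sq nab hab
      trace_BC := trace_eq_zero_of_mk_sq nbc hbc
      trace_ABC := trace_eq_zero_of_mk_sq nabc habc
      trace_AC := rfl }, hA.symm, hB.symm, hC.symm⟩

theorem mk_lift_eq {f : Tet →* PSL(2, F)} {A B C : SL(2, F)} (h0 : f (.of 0) = QuotientGroup.mk A)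
    (h1 : f (.of 1) = QuotientGroup.mk B) (h2 : f (.of 2) = QuotientGroup.mk C)
    (w : FreeGroup (Fin 3)) :
    f (PresentedGroup.mk tetRelators w) = QuotientGroup.mk (FreeGroup.lift ![A, B, C] w) := by
  have : f.comp (PresentedGroup.mk tetRelators) =
      (QuotientGroup.mk' (Subgroup.center SL(2, F))).comp (FreeGroup.lift ![A, B, C]) := by
    refine FreeGroup.ext_hom _ _ fun j => ?_
    fin_cases j
    · simpa [PresentedGroup.of] using h0
    · simpa [PresentedGroup.of] using h1
    · simpa [PresentedGroup.of] using h2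
  exact DFunLike.congr_fun this w

theorem mem_center_of_conj {X Y : SL(2, F)} {Q : GL (Fin 2) F} (h : X.1 * Q.1 = Q.1 * Y.1)
    (hY : Y ∈ Subgroup.center SL(2, F)) : X ∈ Subgroup.center SL(2, F) := by
  rw [mem_center_iff_eq_one_or_neg_one] at hY ⊢
  rcases hY with rfl | rfl
  · left
    refine Subtype.ext (Q.isUnit.mul_right_cancel ?_)
    rw [h]; simp
  · right
    refine Subtype.ext (Q.isUnit.mul_right_cancel ?_)
    rw [h]; simp

theorem mem_center_map_iff {K : Type*} [Field K] (φ : F →+* K) {X : SL(2, F)} :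
    Matrix.SpecialLinearGroup.map φ X ∈ Subgroup.center SL(2, K) ↔
      X ∈ Subgroup.center SL(2, F) := by
  rw [mem_center_iff_eq_one_or_neg_one, mem_center_iff_eq_one_or_neg_one]
  have hinj : Function.Injective (Matrix.SpecialLinearGroup.map (n := Fin 2) φ) := fun X Y h =>
    Subtype.ext (Matrix.map_injective φ.injective (congrArg Subtype.val h))
  have hneg : Matrix.SpecialLinearGroup.map (n := Fin 2) φ (-1) = -1 := by
    refine Subtype.ext ?_
    ext a b
    fin_cases a <;> fin_cases b <;> simp
  rw [← hinj.eq_iff, ← hinj.eq_iff (b := -1), hneg, map_one]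

theorem lift_conj {A B C A' B' C' : SL(2, F)} {Q : GL (Fin 2) F} (hA : A.1 * Q.1 = Q.1 * A'.1)
    (hB : B.1 * Q.1 = Q.1 * B'.1) (hC : C.1 * Q.1 = Q.1 * C'.1) (w : FreeGroup (Fin 3)) :
    (FreeGroup.lift ![A, B, C] w).1 * Q.1 = Q.1 * (FreeGroup.lift ![A', B', C'] w).1 := by
  have e : ∀ X Y : SL(2, F), X.1 * Q.1 = Q.1 * Y.1 ↔
      toGL X = MulAut.conj Q (toGL Y) := fun X Y => by
    rw [MulAut.conj_apply, eq_mul_inv_iff_mul_eq, Units.ext_iff]; rfl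
  rw [e]
  rw [e] at hA hB hC
  have : (toGL (n := Fin 2) (R := F)).comp (FreeGroup.lift ![A, B, C]) =
      (MulAut.conj Q).toMonoidHom.comp
        ((toGL (n := Fin 2) (R := F)).comp (FreeGroup.lift ![A', B', C'])) := by
    refine FreeGroup.ext_hom _ _ fun j => ?_
    fin_cases j
    · simpa using hA
    · simpa using hB
    · simpa using hC
  exact DFunLike.congr_fun this w

theorem map_lift {K : Type*} [Field K] (φ : F →+* K) (A B C : SL(2, F)) (w : FreeGroup (Fin 3)) :
    Matrix.SpecialLinearGroup.map φ (FreeGroup.lift ![A, B, C] w) =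
      FreeGroup.lift ![Matrix.SpecialLinearGroup.map φ A, Matrix.SpecialLinearGroup.map φ B,
        Matrix.SpecialLinearGroup.map φ C] w := by
  have : (Matrix.SpecialLinearGroup.map φ).comp (FreeGroup.lift ![A, B, C]) =
      FreeGroup.lift ![Matrix.SpecialLinearGroup.map φ A, Matrix.SpecialLinearGroup.map φ B,
        Matrix.SpecialLinearGroup.map φ C] := by
    refine FreeGroup.ext_hom _ _ fun j => ?_
    fin_cases j <;> simp
  exact DFunLike.congr_fun this w

/-- Two homomorphisms given by normalized triples with Galois conjugate parameters have the same
kernel. -/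
theorem ker_le_ker (h2 : (2 : F) ≠ 0) (h3 : (3 : F) ≠ 0) {i : F} (hi : i ^ 2 = -1)
    {f f' : Tet →* PSL(2, F)} {A B C A' B' C' : SL(2, F)} {τ z : F} (φ : F →+* F)
    (h : IsTetTriple A B C τ z) (h' : IsTetTriple A' B' C' (φ τ) (φ z))
    (f0 : f (.of 0) = QuotientGroup.mk A) (f1 : f (.of 1) = QuotientGroup.mk B)
    (f2 : f (.of 2) = QuotientGroup.mk C) (f0' : f' (.of 0) = QuotientGroup.mk A')
    (f1' : f' (.of 1) = QuotientGroup.mk B') (f2' : f' (.of 2) = QuotientGroup.mk C') :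
    f.ker = f'.ker := by
  obtain ⟨-, Q, hA, hB, hC⟩ := (h.map φ).exists_conj h2 h3 hi
  obtain ⟨-, Q', hA', hB', hC'⟩ := h'.exists_conj h2 h3 hi
  have hQ : Q.1 * Q⁻¹.1 = 1 := by rw [← Units.val_mul]; simp
  have hQ' : Q'.1 * Q'⁻¹.1 = 1 := by rw [← Units.val_mul]; simp
  have conj : ∀ {X Y N : Matrix (Fin 2) (Fin 2) F} {P R : GL (Fin 2) F}, P.1 * P⁻¹.1 = 1 →
      X * P.1 = P.1 * N → Y * R.1 = R.1 * N →
      Y * (R * P⁻¹).1 = (R * P⁻¹).1 * X := by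
    intro X Y N P R hP hX hY
    have hP' : P⁻¹.1 * P.1 = 1 := by rw [← Units.val_mul]; simp
    have : X = P.1 * N * P⁻¹.1 := by rw [← hX, mul_assoc, hP, mul_one]
    rw [this, Units.val_mul, ← mul_assoc, hY]
    simp only [mul_assoc]
    rw [← mul_assoc P⁻¹.1 P.1, hP', one_mul]
  have k1 := lift_conj (conj hQ hA hA') (conj hQ hB hB') (conj hQ hC hC')
  have k2 := lift_conj (conj hQ' hA' hA) (conj hQ' hB' hB) (conj hQ' hC' hC)
  ext x
  obtain ⟨w, rfl⟩ := PresentedGroup.mk_surjective tetRelators x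
  rw [MonoidHom.mem_ker, MonoidHom.mem_ker, mk_lift_eq f0 f1 f2, mk_lift_eq f0' f1' f2',
    QuotientGroup.eq_one_iff, QuotientGroup.eq_one_iff, ← mem_center_map_iff φ, map_lift]
  exact ⟨mem_center_of_conj (k1 w), mem_center_of_conj (k2 w)⟩

end Matrix.SpecialLinearGroup

open Polynomial in
theorem exists_finite_extension_eq_add_inv (F : Type*) [Field F] [Finite F] :
    ∃ f : F[X], ∀ t : F, ∃ a : f.SplittingField, a ≠ 0 ∧
      algebraMap F f.SplittingField t = a + a⁻¹ := by
  have := Fintype.ofFinite F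
  have hdeg : ∀ t : F, (X ^ 2 - C t * X + C 1 : F[X]).natDegree = 2 := fun t => by compute_degree!
  have hne : ∀ t : F, (X ^ 2 - C t * X + C 1 : F[X]) ≠ 0 := fun t h => by
    have := hdeg t; rw [h] at this; simp at this
  refine ⟨∏ t : F, (X ^ 2 - C t * X + C 1), fun t => ?_⟩
  generalize hf : ∏ t : F, (X ^ 2 - C t * X + C 1 : F[X]) = f
  have hf0 : f ≠ 0 := hf ▸ Finset.prod_ne_zero_iff.2 fun t _ => hne t
  have hs := (SplittingField.splits f).of_dvd ((Polynomial.map_ne_zero_iff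
    (algebraMap F f.SplittingField).injective).2 hf0) (Polynomial.map_dvd
      (algebraMap F f.SplittingField) (hf ▸ Finset.dvd_prod_of_mem
        (fun t : F => (X ^ 2 - C t * X + C 1 : F[X])) (Finset.mem_univ t)))
  obtain ⟨a, ha⟩ := hs.exists_eval_eq_zero (by
    rw [Polynomial.degree_map, Polynomial.degree_eq_natDegree (hne t), hdeg]; norm_num)
  simp at ha
  have ha0 : a ≠ 0 := by rintro rfl; simp at ha
  refine ⟨a, ha0, ?_⟩
  field_simp
  linear_combination -ha

namespace Matrix.SpecialLinearGroup

variable {F : Type*} [Field F]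

theorem card_le [Finite F] :
    Nat.card SL(2, F) ≤ Nat.card F * ((Nat.card F - 1) * (Nat.card F + 1)) := by
  have := Fintype.ofFinite F
  let D : Fˣ → GL (Fin 2) F := fun u =>
    Matrix.GeneralLinearGroup.mkOfDetNeZero !![(u : F), 0; 0, 1] (by simp)
  have hD : ∀ u, (D u).1.det = u := fun u => by simp [D, Matrix.GeneralLinearGroup.mkOfDetNeZero]
  have hinj : Function.Injective fun x : SL(2, F) × Fˣ => toGL x.1 * D x.2 := by
    rintro ⟨g, u⟩ ⟨h, v⟩ e
    have e1 := congrArg (fun x : GL (Fin 2) F => x.1.det) e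
    simp only [Units.val_mul, Matrix.det_mul, hD] at e1
    have e2 : ∀ g : SL(2, F), (toGL g).1.det = 1 := fun g => g.2
    rw [e2, e2, one_mul, one_mul] at e1
    obtain rfl := Units.ext e1
    have := mul_right_cancel e
    rw [Prod.mk.injEq]
    exact ⟨Subtype.ext (congrArg Units.val this), rfl⟩
  have hle := Nat.card_le_card_of_injective _ hinj
  rw [Nat.card_prod, Matrix.card_GL_field, Nat.card_units, Fin.prod_univ_two,
    ← Nat.card_eq_fintype_card] at hle
  obtain ⟨m, hm⟩ : ∃ m, Nat.card F = m + 2 :=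
    ⟨Nat.card F - 2, by have := Finite.one_lt_card (α := F); omega⟩
  rw [hm] at hle ⊢
  refine Nat.le_of_mul_le_mul_right (hle.trans (le_of_eq ?_)) (show 0 < m + 2 - 1 by omega)
  simp only [Fin.val_zero, Fin.val_one, pow_zero, pow_one]
  rw [show (m + 2) ^ 2 - 1 = (m + 1) * (m + 3) by
      rw [Nat.sub_eq_iff_eq_add (by nlinarith)]; ring,
    show (m + 2) ^ 2 - (m + 2) = (m + 2) * (m + 1) by
      rw [Nat.sub_eq_iff_eq_add (by nlinarith)]; ring, show m + 2 - 1 = m + 1 from rfl]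
  ring

theorem sq_smul_eq_of_card_orbit_lt {G X : Type*} [Group G] [MulAction G X] [Finite X] (x : X)
    (h : Nat.card (orbit G x) < 3) (g : G) : g • g • x = x := by
  by_contra hne
  have h1 : g • x ≠ x := fun h => hne (by rw [h, h])
  have h2 : g • g • x ≠ g • x := fun h => h1 (smul_left_cancel g h)
  have : ({x, g • x, g • g • x} : Set X).ncard = 3 :=
    Set.ncard_eq_three.2 ⟨_, _, _, h1.symm, Ne.symm hne, h2.symm, rfl⟩
  have hsub : ({x, g • x, g • g • x} : Set X) ⊆ orbit G x := by
    rintro y (rfl | rfl | rfl)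
    exacts [mem_orbit_self _, mem_orbit _ _, ⟨g * g, mul_smul _ _ _⟩]
  have := Set.ncard_le_ncard hsub (Set.toFinite _)
  rw [← Nat.card_coe_set_eq (orbit G x)] at this
  omega

theorem neg_one_smul_projectivization (x : ℙ F (Fin 2 → F)) : (-1 : SL(2, F)) • x = x := by
  induction x using Projectivization.ind with
  | h v hv => exact (smul_mk_eq_self_iff _ hv).2 ⟨-1, by simp⟩

/-- A subgroup containing a normalized triple has no small orbit on the projective line. -/
theorem IsTetTriple.three_le_card_orbit [Finite F] (h3 : (3 : F) ≠ 0) {A B C : SL(2, F)} {τ z : F}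
    (h : IsTetTriple A B C τ z) {Γ : Subgroup SL(2, F)} (hA : A ∈ Γ) (hB : B ∈ Γ) (hC : C ∈ Γ)
    (x : ℙ F (Fin 2 → F)) : 3 ≤ Nat.card (orbit Γ x) := by
  by_contra hlt
  have hsq : ∀ g ∈ Γ, g • g • x = x := fun g hg =>
    sq_smul_eq_of_card_orbit_lt x (not_le.1 hlt) (⟨g, hg⟩ : Γ)
  have cube : ∀ g ∈ Γ, g ^ 3 = -1 → g • x = x := fun g hg hg3 => by
    have e : g ^ 3 • x = g • g • g • x := by simp only [pow_succ, pow_zero, one_mul, mul_smul]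
    rw [hg3, neg_one_smul_projectivization, hsq g hg] at e
    exact e.symm
  have fA := cube A hA (pow_three_eq_neg_one h.trace_A)
  have fC := cube C hC (pow_three_eq_neg_one h.trace_C)
  have fB : B • x = x := by
    have e : B ^ 5 • x = B • B • B • B • B • x := by
      simp only [pow_succ, pow_zero, one_mul, mul_smul]
    rw [pow_five_eq_neg_one (by rw [h.trace_B, h.golden]), neg_one_smul_projectivization,
      hsq B hB, hsq B hB] at e
    exact e.symm
  obtain ⟨k, rfl⟩ := exists_smul_pointAtInfty_eq x
  obtain ⟨a, ha⟩ : ∃ a : stabilizer Γ (k • pointAtInfty F), (a : Γ).1 = A := ⟨⟨⟨A, hA⟩, fA⟩, rfl⟩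
  obtain ⟨b, hb⟩ : ∃ b : stabilizer Γ (k • pointAtInfty F), (b : Γ).1 = B := ⟨⟨⟨B, hB⟩, fB⟩, rfl⟩
  obtain ⟨c, hc⟩ : ∃ c : stabilizer Γ (k • pointAtInfty F), (c : Γ).1 = C := ⟨⟨⟨C, hC⟩, fC⟩, rfl⟩
  have h0 : ∀ g : stabilizer Γ (k • pointAtInfty F), Matrix.trace (g : Γ).1.1 = 0 →
      (multiplier Γ k g) ^ 2 = -1 := fun g hg => by
    rw [trace_eq_multiplier] at hg
    have := (multiplier Γ k g).ne_zero
    field_simp at hg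
    exact Units.ext (by push_cast; linear_combination hg)
  have hbc := h0 (b * c) (by simpa [ha, hb, hc] using h.trace_BC)
  have habc := h0 (a * b * c) (by simpa [ha, hb, hc] using h.trace_ABC)
  have hsq : multiplier Γ k a ^ 2 = 1 := by
    rw [mul_assoc, map_mul, mul_pow, hbc] at habc
    simpa using habc
  rw [← trace_sq_eq_four_iff, ha, h.trace_A] at hsq
  exact h3 (by linear_combination -hsq)

theorem exists_monoidHom_of_isTetTriple {A B C : SL(2, F)} {τ z : F}
    (h : IsTetTriple A B C τ z) : ∃ f : Tet →* PSL(2, F), f (.of 0) = QuotientGroup.mk A ∧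
      f (.of 1) = QuotientGroup.mk B ∧ f (.of 2) = QuotientGroup.mk C := by
  have hmk : (QuotientGroup.mk (-1) : PSL(2, F)) = 1 :=
    (mk_neg 1).trans rfl
  have hA := pow_three_eq_neg_one h.trace_A
  have hC := pow_three_eq_neg_one h.trace_C
  have hB : B ^ 5 = -1 := pow_five_eq_neg_one (by rw [h.trace_B, h.golden])
  have hAB := sq_eq_neg_one h.trace_AB
  have hBC := sq_eq_neg_one h.trace_BC
  have hABC := sq_eq_neg_one h.trace_ABC
  have hrel : ∀ r ∈ tetRelators, FreeGroup.lift
      ![(QuotientGroup.mk A : PSL(2, F)), QuotientGroup.mk B, QuotientGroup.mk C] r = 1 := by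
    simp only [tetRelators, Set.mem_insert_iff, Set.mem_singleton_iff, forall_eq_or_imp,
      forall_eq, map_pow, map_mul, FreeGroup.lift_apply_of]
    refine ⟨?_, ?_, ?_, ?_, ?_, ?_⟩
    · exact (congrArg QuotientGroup.mk hA).trans hmk
    · exact (congrArg QuotientGroup.mk hB).trans hmk
    · exact (congrArg QuotientGroup.mk hC).trans hmk
    · exact (congrArg QuotientGroup.mk hAB).trans hmk
    · exact (congrArg QuotientGroup.mk hBC).trans hmk
    · exact (congrArg QuotientGroup.mk hABC).trans hmk
  refine ⟨PresentedGroup.toGroup hrel, ?_, ?_, ?_⟩ <;> rw [PresentedGroup.toGroup.of] <;> rfl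

theorem surjective_of_isTetTriple {p : ℕ} [Fact p.Prime] [Finite F] [CharP F p] (hp : 7 ≤ p)
    (h5 : p % 5 = 2 ∨ p % 5 = 3) (hF : Nat.card F = p ^ 4) {A B C : SL(2, F)} {τ z : F}
    (h : IsTetTriple A B C τ z) (hz : z ^ p ^ 2 = 1 - z) (h2z : 2 * z ≠ 1)
    {f : Tet →* PSL(2, F)} (f0 : f (.of 0) = QuotientGroup.mk A)
    (f1 : f (.of 1) = QuotientGroup.mk B) (f2 : f (.of 2) = QuotientGroup.mk C) :
    Function.Surjective f := by
  have hp2 : p ≠ 2 := by omega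
  let H : Subgroup SL(2, F) := f.range.comap (QuotientGroup.mk' (Subgroup.center SL(2, F)))
  have hA : A ∈ H := ⟨_, f0⟩
  have hB : B ∈ H := ⟨_, f1⟩
  have hC : C ∈ H := ⟨_, f2⟩
  have hneg : (-1 : SL(2, F)) ∈ H := by
    refine Subgroup.mem_comap.2 ?_
    have : QuotientGroup.mk' (Subgroup.center SL(2, F)) (-1) = 1 := (mk_neg 1).trans rfl
    rw [this]
    exact one_mem _
  suffices hH : H = ⊤ by
    intro x
    obtain ⟨g, rfl⟩ := QuotientGroup.mk_surjective x
    have : g ∈ H := hH ▸ Subgroup.mem_top g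
    exact this
  obtain ⟨q, hq⟩ := exists_finite_extension_eq_add_inv F
  let φ := algebraMap F q.SplittingField
  have hinj : Function.Injective (Matrix.SpecialLinearGroup.map (n := Fin 2) φ) := fun X Y h =>
    Subtype.ext (Matrix.map_injective φ.injective (congrArg Subtype.val h))
  let Γ := H.map (Matrix.SpecialLinearGroup.map φ)
  have hcard : Nat.card Γ = Nat.card H := Subgroup.card_map_of_injective hinj
  have h3 : (3 : q.SplittingField) ≠ 0 := fun h => by
    have := (CharP.cast_eq_zero_iff q.SplittingField p 3).1 (by exact_mod_cast h)
    have := Nat.le_of_dvd (by norm_num) this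
    omega
  have hz' : φ z ^ p ^ 2 = 1 - φ z := by rw [← map_pow, hz]; simp
  have h2z' : 2 * φ z ≠ 1 := fun h => h2z (φ.injective (by rw [map_mul, map_ofNat, h, map_one]))
  have hmem : ∀ {X}, X ∈ H → Matrix.SpecialLinearGroup.map φ X ∈ Γ :=
    fun hX => Subgroup.mem_map_of_mem _ hX
  have hAC : Matrix.trace (Matrix.SpecialLinearGroup.map φ (A * C)).1 = φ z := by
    rw [trace_map, h.trace_AC]
  have hACmem := hmem (mul_mem hA hC)
  have hnegΓ : -1 ∈ Γ := by
    have : Matrix.SpecialLinearGroup.map (n := Fin 2) φ (-1) = -1 := by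
      refine Subtype.ext ?_
      ext a b
      fin_cases a <;> fin_cases b <;> simp
    rw [← this]
    exact hmem hneg
  rcases trace_of_three_le_orbit p hp Γ hnegΓ
    (by
      rintro _ ⟨g, -, rfl⟩
      rw [trace_map]
      exact hq _)
    (fun x => (h.map φ).three_le_card_orbit h3 (hmem hA) (hmem hB) (hmem hC) x) with
    hsmall | ⟨k, hk, hk0, hpow⟩
  · obtain ⟨n, hn, hn5, a, ha, hza, han⟩ := hsmall _ hACmem
    rw [hAC] at hza
    exact (false_of_small_order hp2 h5 hz' h2z' ha hza hn hn5 han).elim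
  · have h4 := four_dvd_of_pow_char_pow_eq hz' h2z' (by simpa only [hAC] using hpow _ hACmem) hp2
    refine Subgroup.eq_top_of_le_card _ (card_le.trans (le_trans ?_ (hcard ▸ hk)))
    have : p ^ 4 ≤ p ^ k :=
      Nat.pow_le_pow_right (by omega) (Nat.le_of_dvd (Nat.pos_of_ne_zero hk0) h4)
    rw [hF]
    gcongr

end Matrix.SpecialLinearGroup

theorem stmt_6 (p : ℕ) [Fact p.Prime] (hp : p ≠ 2)
    (h5 : p % 5 = 2 ∨ p % 5 = 3)
    (s : GaloisField p 2) (hs : s ^ 2 = 5)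
    (hns : ¬ IsSquare (3 + 2 * s) ∧ ¬ IsSquare (3 - 2 * s)) :
    ∃! K : Subgroup Tet, IsPSLQuotient (GaloisField p 4) K := by
  have hp7 := seven_le_of_not_isSquare hp h5 hs hns.1
  have hcard : Nat.card (GaloisField p 4) = p ^ 4 := GaloisField.card p 4 (by norm_num)
  have : Fintype (GaloisField p 4) := Fintype.ofFinite _
  have h2 : (2 : GaloisField p 4) ≠ 0 := fun h => by
    have := (CharP.cast_eq_zero_iff (GaloisField p 4) p 2).1 (by exact_mod_cast h)
    have := Nat.le_of_dvd (by norm_num) this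
    omega
  have h3 : (3 : GaloisField p 4) ≠ 0 := fun h => by
    have := (CharP.cast_eq_zero_iff (GaloisField p 4) p 3).1 (by exact_mod_cast h)
    have := Nat.le_of_dvd (by norm_num) this
    omega
  obtain ⟨ι⟩ : Nonempty (GaloisField p 2 →ₐ[ZMod p] GaloisField p 4) :=
    FiniteField.nonempty_algHom_of_finrank_dvd (by
      rw [GaloisField.finrank p (by norm_num), GaloisField.finrank p (by norm_num)]; norm_num)
  have hpow : ∀ τ z : GaloisField p 4, τ ^ 2 = τ + 1 → z ^ 2 = z + 1 - τ →
      z ^ p ^ 2 = 1 - z ∧ 2 * z ≠ 1 :=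
    fun τ z hτ hz => pow_char_sq_eq hp ι.toRingHom hs hns hτ hz
  obtain ⟨τ, z, i, hτ, hz, hi⟩ := exists_golden_data hp
    (by rw [← Nat.card_eq_fintype_card, hcard]) ι.toRingHom hs
  obtain ⟨A, B, C, h⟩ := Matrix.SpecialLinearGroup.exists_isTetTriple h2 h3 hi hτ hz
  obtain ⟨f, f0, f1, f2⟩ := Matrix.SpecialLinearGroup.exists_monoidHom_of_isTetTriple h
  obtain ⟨hzp, h2z⟩ := hpow τ z hτ hz
  refine ⟨f.ker, ⟨f, Matrix.SpecialLinearGroup.surjective_of_isTetTriple hp7 h5 hcard h hzp h2z f0 f1 f2, rfl⟩, ?_⟩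
  rintro _ ⟨f', hf', rfl⟩
  obtain ⟨A', B', C', τ', z', h', f0', f1', f2'⟩ := Matrix.SpecialLinearGroup.exists_isTetTriple_of_surjective f' hf'
  obtain ⟨φ, rfl, rfl⟩ := exists_ringHom_map_eq hp h5 (fun τ z hτ hz => (hpow τ z hτ hz).1)
    hτ hz h'.golden (h'.exists_conj h2 h3 hi).1
  exact (Matrix.SpecialLinearGroup.ker_le_ker h2 h3 hi φ h h' f0 f1 f2 f0' f1' f2').symm
end

section
/- Let Δ be the tetrahedral group [3,5,3]⁺. There exists a (unique) group automorphism ρ of Δ with ρ(α) = γ⁻¹, ρ(β) = β⁻¹ and ρ(γ) = α⁻¹; it satisfies ρ∘ρ = id, and for every prime power q and every normal subgroup K of Δ with Δ/K isomorphic to PSL(2, F_q), one has ρ(K) = K. -/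
/-- `ρ` sends `α ↦ γ⁻¹`, `β ↦ β⁻¹`, `γ ↦ α⁻¹` on the generators of `Δ`. -/
def RhoSpec (ρ : MulAut Tet) : Prop :=
  ρ (PresentedGroup.of 0) = (PresentedGroup.of 2)⁻¹ ∧
  ρ (PresentedGroup.of 1) = (PresentedGroup.of 1)⁻¹ ∧
  ρ (PresentedGroup.of 2) = (PresentedGroup.of 0)⁻¹

namespace Tet

/-- The standard generators of `Δ`. -/
abbrev α : Tet := PresentedGroup.of 0
abbrev β : Tet := PresentedGroup.of 1
abbrev γ : Tet := PresentedGroup.of 2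

/-- Triples in a group satisfying the defining relations of `Δ`. -/
structure IsTriple {G : Type*} [Group G] (a b c : G) : Prop where
  a_pow : a ^ 3 = 1
  b_pow : b ^ 5 = 1
  c_pow : c ^ 3 = 1
  ab_sq : (a * b) ^ 2 = 1
  bc_sq : (b * c) ^ 2 = 1
  abc_sq : (a * b * c) ^ 2 = 1

lemma isTriple_gen : IsTriple α β γ := by
  have key : ∀ r ∈ tetRelators, PresentedGroup.mk tetRelators r = 1 := fun r hr =>
    PresentedGroup.one_of_mem hr
  constructor
  · exact key (FreeGroup.of 0 ^ 3) (by simp [tetRelators])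
  · exact key (FreeGroup.of 1 ^ 5) (by simp [tetRelators])
  · exact key (FreeGroup.of 2 ^ 3) (by simp [tetRelators])
  · exact key ((FreeGroup.of 0 * FreeGroup.of 1) ^ 2) (by simp [tetRelators])
  · exact key ((FreeGroup.of 1 * FreeGroup.of 2) ^ 2) (by simp [tetRelators])
  · exact key ((FreeGroup.of 0 * FreeGroup.of 1 * FreeGroup.of 2) ^ 2) (by simp [tetRelators])

namespace IsTriple

variable {G : Type*} [Group G] {a b c : G}

lemma map {H : Type*} [Group H] (f : G →* H) (h : IsTriple a b c) :
    IsTriple (f a) (f b) (f c) := by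
  constructor <;> simp only [← map_mul, ← map_pow, h.a_pow, h.b_pow, h.c_pow, h.ab_sq, h.bc_sq,
    h.abc_sq, map_one]

lemma reverse (h : IsTriple a b c) : IsTriple c⁻¹ b⁻¹ a⁻¹ := by
  constructor <;> simp only [← mul_inv_rev, inv_pow, inv_eq_one, ← mul_assoc, h.a_pow, h.b_pow,
    h.c_pow, h.ab_sq, h.bc_sq, h.abc_sq]

lemma eq_one_of_coprime {g : G} {m n : ℕ} (hm : g ^ m = 1) (hn : g ^ n = 1)
    (hmn : m.Coprime n) : g = 1 := by
  simpa [hmn] using pow_gcd_eq_one.2 ⟨hm, hn⟩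

lemma degenerate_of_left (h : IsTriple a b c) (ha : a = 1) : a = 1 ∧ b = 1 ∧ c = 1 := by
  subst ha
  have hb : b = 1 := eq_one_of_coprime (by simpa using h.ab_sq) h.b_pow (by norm_num)
  subst hb
  exact ⟨rfl, rfl, eq_one_of_coprime (by simpa using h.bc_sq) h.c_pow (by norm_num)⟩

lemma degenerate_of_right (h : IsTriple a b c) (hc : c = 1) : a = 1 ∧ b = 1 ∧ c = 1 := by
  have := h.reverse.degenerate_of_left (by simpa using hc)
  simp only [inv_eq_one] at this
  tauto

lemma degenerate_of_mul_left (h : IsTriple a b c) (hab : a * b = 1) :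
    a = 1 ∧ b = 1 ∧ c = 1 :=
  h.degenerate_of_right
    (eq_one_of_coprime (by simpa [hab] using h.abc_sq) h.c_pow (by norm_num))

lemma degenerate_of_mul_right (h : IsTriple a b c) (hbc : b * c = 1) :
    a = 1 ∧ b = 1 ∧ c = 1 :=
  h.degenerate_of_left
    (eq_one_of_coprime (by simpa [mul_assoc, hbc] using h.abc_sq) h.a_pow (by norm_num))

lemma degenerate_of_mul (h : IsTriple a b c) (habc : a * b * c = 1) :
    a = 1 ∧ b = 1 ∧ c = 1 := by
  refine h.degenerate_of_right (eq_one_of_coprime (m := 2) ?_ h.c_pow (by norm_num))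
  rw [eq_inv_of_mul_eq_one_right habc, inv_pow, h.ab_sq, inv_one]

/-- The homomorphism out of `Δ` defined by a triple. -/
def lift (h : IsTriple a b c) : Tet →* G :=
  PresentedGroup.toGroup (f := ![a, b, c]) (rels := tetRelators) <| by
    rintro r (rfl | rfl | rfl | rfl | rfl | rfl) <;>
      simp [h.a_pow, h.b_pow, h.c_pow, h.ab_sq, h.bc_sq, h.abc_sq]

@[simp] lemma lift_α (h : IsTriple a b c) : h.lift α = a := PresentedGroup.toGroup.of _
@[simp] lemma lift_β (h : IsTriple a b c) : h.lift β = b := PresentedGroup.toGroup.of _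
@[simp] lemma lift_γ (h : IsTriple a b c) : h.lift γ = c := PresentedGroup.toGroup.of _

end IsTriple

lemma hom_ext {G : Type*} [Group G] {f g : Tet →* G} (hα : f α = g α) (hβ : f β = g β)
    (hγ : f γ = g γ) : f = g := by
  refine PresentedGroup.ext fun i => ?_
  fin_cases i
  exacts [hα, hβ, hγ]

/-- `Δ` is generated by the involutions `αβ`, `βγ` and `αβγ`. -/
lemma eq_top_of_involutions_mem {N : Subgroup Tet} (hX : α * β ∈ N) (hY : β * γ ∈ N)
    (hZ : α * β * γ ∈ N) : N = ⊤ := by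
  have hα : α ∈ N := by simpa [mul_assoc] using N.mul_mem hZ (N.inv_mem hY)
  have hγ : γ ∈ N := by simpa [mul_assoc] using N.mul_mem (N.inv_mem hX) hZ
  have hβ : β ∈ N := by simpa using N.mul_mem (N.inv_mem hα) hX
  rw [eq_top_iff, ← PresentedGroup.closure_range_of, Subgroup.closure_le]
  rintro _ ⟨i, rfl⟩
  fin_cases i
  exacts [hα, hβ, hγ]

/-- The endomorphism `α ↦ γ⁻¹`, `β ↦ β⁻¹`, `γ ↦ α⁻¹` of `Δ`. -/
def rhoHom : Tet →* Tet := isTriple_gen.reverse.lift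

lemma rhoHom_comp_rhoHom : rhoHom.comp rhoHom = MonoidHom.id Tet := by
  apply hom_ext <;> simp [rhoHom]

/-- The automorphism `ρ` of `Δ`. -/
def rho : MulAut Tet := rhoHom.toMulEquiv rhoHom rhoHom_comp_rhoHom rhoHom_comp_rhoHom

lemma rhoSpec_iff {ρ : MulAut Tet} : RhoSpec ρ ↔ ρ = rho := by
  have h : RhoSpec rho := by
    refine ⟨?_, ?_, ?_⟩ <;> simp [rho, rhoHom]
  refine ⟨fun hρ => ?_, fun hρ => hρ ▸ h⟩
  have : ρ.toMonoidHom = rho.toMonoidHom :=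
    hom_ext (hρ.1.trans h.1.symm) (hρ.2.1.trans h.2.1.symm) (hρ.2.2.trans h.2.2.symm)
  exact MulEquiv.ext fun x => DFunLike.congr_fun this x

lemma rho_rho (x : Tet) : rho (rho x) = x := DFunLike.congr_fun rhoHom_comp_rhoHom x

lemma rho_α : rho α = γ⁻¹ := (rhoSpec_iff.2 rfl).1
lemma rho_β : rho β = β⁻¹ := (rhoSpec_iff.2 rfl).2.1
lemma rho_γ : rho γ = α⁻¹ := (rhoSpec_iff.2 rfl).2.2

lemma map_rho_eq_of_le_comap {K : Subgroup Tet} (h : ∀ x ∈ K, rho x ∈ K) :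
    K.map rho.toMonoidHom = K := by
  refine le_antisymm (Subgroup.map_le_iff_le_comap.2 h) fun x hx => ?_
  exact ⟨rho x, h x hx, rho_rho x⟩

section PSL

variable {F : Type*} [Field F]

/-- The projection `SL(2, F) → PSL(2, F)`. -/
abbrev proj :
    Matrix.SpecialLinearGroup (Fin 2) F →* Matrix.ProjectiveSpecialLinearGroup (Fin 2) F :=
  QuotientGroup.mk' _

lemma proj_surjective : Function.Surjective (proj (F := F)) := QuotientGroup.mk'_surjective _

lemma proj_eq_one_iff {s : Matrix.SpecialLinearGroup (Fin 2) F} :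
    proj s = 1 ↔ ∃ r : F, (s : Matrix (Fin 2) (Fin 2) F) = r • 1 := by
  rw [QuotientGroup.mk'_apply, QuotientGroup.eq_one_iff, Matrix.SpecialLinearGroup.mem_center_iff]
  refine ⟨fun ⟨r, _, h⟩ => ⟨r, by rw [← h, Matrix.smul_one_eq_diagonal]; rfl⟩,
    fun ⟨r, h⟩ => ⟨r, ?_, ?_⟩⟩
  · have := s.det_coe
    rw [h] at this
    simpa using this
  · rw [h, Matrix.smul_one_eq_diagonal]; rfl

lemma proj_neg (s : Matrix.SpecialLinearGroup (Fin 2) F) : proj (-s) = proj s := by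
  have : proj (-1 : Matrix.SpecialLinearGroup (Fin 2) F) = 1 := proj_eq_one_iff.2 ⟨-1, by simp⟩
  rw [← neg_one_mul, map_mul, this, one_mul]

lemma proj_eq_one_of_smul_add {s : Matrix.SpecialLinearGroup (Fin 2) F} {k r : F} (hk : k ≠ 0)
    (h : k • (s : Matrix (Fin 2) (Fin 2) F) = r • 1) : proj s = 1 :=
  proj_eq_one_iff.2 ⟨k⁻¹ * r, by rw [mul_smul, ← h, inv_smul_smul₀ hk]⟩

lemma sq_eq_trace_smul_sub (s : Matrix.SpecialLinearGroup (Fin 2) F) :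
    (s : Matrix (Fin 2) (Fin 2) F) * s =
      Matrix.trace (s : Matrix (Fin 2) (Fin 2) F) • (s : Matrix (Fin 2) (Fin 2) F)
      - 1 := by
  have := Matrix.aeval_self_charpoly (s : Matrix (Fin 2) (Fin 2) F)
  rw [Matrix.charpoly_fin_two] at this
  simp [Algebra.algebraMap_eq_smul_one, sq] at this
  rw [← sub_eq_zero, ← this]
  abel

lemma trace_eq_zero_of_involution {s : Matrix.SpecialLinearGroup (Fin 2) F} (h1 : proj s ≠ 1)
    (h2 : proj s ^ 2 = 1) : Matrix.trace (s : Matrix (Fin 2) (Fin 2) F) = 0 := by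
  by_contra ht
  rw [← map_pow, proj_eq_one_iff] at h2
  obtain ⟨r, hr⟩ := h2
  rw [sq, Matrix.SpecialLinearGroup.coe_mul, sq_eq_trace_smul_sub] at hr
  exact h1 (proj_eq_one_of_smul_add (r := r + 1) ht (by rw [add_smul, one_smul, ← hr]; abel))

lemma trace_sq_eq_one_of_pow_three {s : Matrix.SpecialLinearGroup (Fin 2) F} (h1 : proj s ≠ 1)
    (h3 : proj s ^ 3 = 1) : Matrix.trace (s : Matrix (Fin 2) (Fin 2) F) ^ 2 = 1 := by
  by_contra ht
  rw [← map_pow, proj_eq_one_iff] at h3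
  obtain ⟨r, hr⟩ := h3
  rw [pow_succ, sq, Matrix.SpecialLinearGroup.coe_mul, Matrix.SpecialLinearGroup.coe_mul,
    sq_eq_trace_smul_sub, sub_mul, smul_mul_assoc, one_mul, sq_eq_trace_smul_sub] at hr
  refine h1 (proj_eq_one_of_smul_add (r := r + Matrix.trace (s : Matrix (Fin 2) (Fin 2) F))
    (sub_ne_zero.2 ht) ?_)
  rw [add_smul, ← hr]
  module

/-- `m * n + n * m` is the scalar `tr (m * n)` for traceless `2 × 2` matrices. -/
lemma mul_add_mul_of_trace_eq_zero {m n : Matrix (Fin 2) (Fin 2) F} (hm : Matrix.trace m = 0)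
    (hn : Matrix.trace n = 0) : m * n + n * m = Matrix.trace (m * n) • 1 := by
  rw [Matrix.trace_fin_two] at hm hn
  ext i j
  fin_cases i <;> fin_cases j <;> simp [Matrix.mul_apply, Matrix.trace_fin_two] <;> grind

lemma eq_zero_of_mul_mul_self {g : Matrix (Fin 2) (Fin 2) F}
    (h : ∀ s : Matrix.SpecialLinearGroup (Fin 2) F, g * s * g = 0) : g = 0 := by
  have h1 := h 1
  have h2 := h ⟨!![1, 1; 0, 1], by simp⟩
  have h3 := h ⟨!![1, 0; 1, 1], by simp⟩
  simp only [← Matrix.ext_iff, Fin.forall_fin_two, Matrix.mul_apply, Fin.sum_univ_two]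
    at h1 h2 h3 ⊢
  simp at h1 h2 h3 ⊢
  grind

/-- A common anti-intertwiner `g` of generators, if singular and nonzero, would make the image
of `f` fix the line `ker g`. -/
lemma det_ne_zero_of_surjective {f : Tet →* Matrix.ProjectiveSpecialLinearGroup (Fin 2) F}
    (hf : Function.Surjective f) {g : Matrix (Fin 2) (Fin 2) F} (hg : g ≠ 0)
    (htr : Matrix.trace g = 0)
    (hgen : ∀ w ∈ ({α * β, β * γ, α * β * γ} : Set Tet),
      ∃ s t : Matrix.SpecialLinearGroup (Fin 2) F, proj s = f w ∧ g * s = t * g) :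
    g.det ≠ 0 := by
  intro hdet
  let N : Subgroup Tet :=
    { carrier := {w | ∃ s : Matrix.SpecialLinearGroup (Fin 2) F, proj s = f w ∧
        ∀ m : Matrix (Fin 2) (Fin 2) F, g * s * m = 0 ↔ g * m = 0}
      one_mem' := ⟨1, by simp, by simp⟩
      mul_mem' := by
        rintro v w ⟨s, hs, hs'⟩ ⟨t, ht, ht'⟩
        refine ⟨s * t, by rw [map_mul, map_mul, hs, ht], fun m => ?_⟩
        have := (hs' (t * m)).trans (mul_assoc g _ m ▸ ht' m)
        simpa only [Matrix.SpecialLinearGroup.coe_mul, mul_assoc] using this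
      inv_mem' := by
        rintro w ⟨s, hs, hs'⟩
        refine ⟨s⁻¹, by rw [map_inv, map_inv, hs], fun m => ?_⟩
        rw [mul_assoc, ← hs', mul_assoc, ← mul_assoc (s : Matrix (Fin 2) (Fin 2) F),
          ← Matrix.SpecialLinearGroup.coe_mul]
        simp }
  have hN : N = ⊤ := by
    have key : ∀ w ∈ ({α * β, β * γ, α * β * γ} : Set Tet), w ∈ N := by
      intro w hw
      obtain ⟨s, t, hs, hst⟩ := hgen w hw
      refine ⟨s, hs, fun m => ?_⟩
      rw [hst, mul_assoc]
      refine ⟨fun h => ?_, fun h => by rw [h, mul_zero]⟩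
      have := congrArg (fun m' : Matrix (Fin 2) (Fin 2) F =>
        (t⁻¹ : Matrix.SpecialLinearGroup (Fin 2) F) * m') h
      simpa only [← mul_assoc, ← Matrix.SpecialLinearGroup.coe_mul, inv_mul_cancel,
        Matrix.SpecialLinearGroup.coe_one, one_mul, mul_zero] using this
    exact eq_top_of_involutions_mem (key _ (by simp)) (key _ (by simp)) (key _ (by simp))
  have hgg : g * g = 0 := by
    rw [Matrix.trace_fin_two] at htr
    rw [Matrix.det_fin_two] at hdet
    ext i j
    fin_cases i <;> fin_cases j <;> simp [Matrix.mul_apply] <;> grind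
  refine hg (eq_zero_of_mul_mul_self fun s => ?_)
  obtain ⟨w, hw⟩ := hf (proj s)
  obtain ⟨s', hs', h⟩ : w ∈ N := hN ▸ Subgroup.mem_top w
  obtain ⟨r, hr⟩ := proj_eq_one_iff.1 (show proj (s'⁻¹ * s) = 1 by
    rw [map_mul, map_inv, hs', hw, inv_mul_cancel])
  have : (s : Matrix (Fin 2) (Fin 2) F) = r • (s' : Matrix (Fin 2) (Fin 2) F) := by
    rw [← mul_inv_cancel_left s' s, Matrix.SpecialLinearGroup.coe_mul, hr]
    simp
  rw [this, mul_smul_comm, smul_mul_assoc, (h g).2 hgg, smul_zero]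

lemma map_rho_eq_one_of_intertwiner {f : Tet →* Matrix.ProjectiveSpecialLinearGroup (Fin 2) F}
    {g : Matrix (Fin 2) (Fin 2) F} (hg : g.det ≠ 0)
    (hgen : ∀ w ∈ ({α * β, β * γ, α * β * γ} : Set Tet),
      ∃ s t : Matrix.SpecialLinearGroup (Fin 2) F,
        proj s = f w ∧ proj t = f (rho w) ∧ g * s = t * g)
    {w : Tet} (hw : f w = 1) : f (rho w) = 1 := by
  let N : Subgroup Tet :=
    { carrier := {w | ∃ s t : Matrix.SpecialLinearGroup (Fin 2) F,
        proj s = f w ∧ proj t = f (rho w) ∧ g * s = t * g}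
      one_mem' := ⟨1, 1, by simp, by simp, by simp⟩
      mul_mem' := by
        rintro v w ⟨s, t, hs, ht, h⟩ ⟨s', t', hs', ht', h'⟩
        refine ⟨s * s', t * t', by simp only [map_mul, hs, hs'],
          by simp only [map_mul, ht, ht'], ?_⟩
        rw [Matrix.SpecialLinearGroup.coe_mul, Matrix.SpecialLinearGroup.coe_mul, ← mul_assoc, h,
          mul_assoc, h', mul_assoc]
      inv_mem' := by
        rintro w ⟨s, t, hs, ht, h⟩
        refine ⟨s⁻¹, t⁻¹, by simp only [map_inv, hs], by simp only [map_inv, ht], ?_⟩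
        have := congrArg (fun m : Matrix (Fin 2) (Fin 2) F =>
          (t⁻¹ : Matrix.SpecialLinearGroup (Fin 2) F) * m *
            (s⁻¹ : Matrix.SpecialLinearGroup (Fin 2) F)) h
        simp only [mul_assoc, ← Matrix.SpecialLinearGroup.coe_mul, mul_inv_cancel] at this
        simp only [← mul_assoc, ← Matrix.SpecialLinearGroup.coe_mul, inv_mul_cancel] at this
        simpa using this.symm }
  have hN : N = ⊤ := eq_top_of_involutions_mem (hgen _ (by simp)) (hgen _ (by simp))
    (hgen _ (by simp))
  obtain ⟨s, t, hs, ht, h⟩ : w ∈ N := hN ▸ Subgroup.mem_top w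
  rw [hw] at hs
  obtain ⟨r, hr⟩ := proj_eq_one_iff.1 hs
  have hg' : IsUnit g := (Matrix.isUnit_iff_isUnit_det g).2 (isUnit_iff_ne_zero.2 hg)
  rw [← ht, proj_eq_one_iff]
  refine ⟨r, hg'.mul_right_cancel ?_⟩
  rw [← h, hr]
  simp

lemma map_rho_eq_one {f : Tet →* Matrix.ProjectiveSpecialLinearGroup (Fin 2) F}
    (hf : Function.Surjective f) {w : Tet} (hw : f w = 1) : f (rho w) = 1 := by
  have hT := isTriple_gen.map f
  by_cases hdeg : f α = 1 ∧ f β = 1 ∧ f γ = 1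
  · rw [show f = 1 from hom_ext hdeg.1 hdeg.2.1 hdeg.2.2, MonoidHom.one_apply]
  obtain ⟨x, hx⟩ := proj_surjective (f (α * β))
  obtain ⟨y, hy⟩ := proj_surjective (f (β * γ))
  obtain ⟨z, hz⟩ := proj_surjective (f (α * β * γ))
  have hx2 : proj x ^ 2 = 1 := by simpa [hx] using hT.ab_sq
  have hy2 : proj y ^ 2 = 1 := by simpa [hy] using hT.bc_sq
  have hz2 : proj z ^ 2 = 1 := by simpa [hz] using hT.abc_sq
  have hx0 := trace_eq_zero_of_involution
    (fun h => hdeg (hT.degenerate_of_mul_left (by rw [← map_mul, ← hx, h]))) hx2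
  have hy0 := trace_eq_zero_of_involution
    (fun h => hdeg (hT.degenerate_of_mul_right (by rw [← map_mul, ← hy, h]))) hy2
  have hz0 := trace_eq_zero_of_involution
    (fun h => hdeg (hT.degenerate_of_mul (by rw [← map_mul, ← map_mul, ← hz, h]))) hz2
  have hinv : ∀ s : Matrix.SpecialLinearGroup (Fin 2) F, proj s ^ 2 = 1 →
      (proj s)⁻¹ = proj s := fun s hs => inv_eq_of_mul_eq_one_left (sq (proj s) ▸ hs)
  have hxz : proj (x * z) = f γ := by
    rw [map_mul, ← hinv x hx2, hx, hz, ← map_inv, ← map_mul]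
    simp [mul_assoc]
  have hzy : proj (z * y) = f α := by
    rw [map_mul, ← hinv y hy2, hy, hz, ← map_inv, ← map_mul]
    simp [mul_assoc]
  have htxz := trace_sq_eq_one_of_pow_three
    (fun h => hdeg (hT.degenerate_of_right (hxz ▸ h))) (hxz ▸ hT.c_pow)
  have htzy := trace_sq_eq_one_of_pow_three
    (fun h => hdeg (hT.degenerate_of_left (hzy ▸ h))) (hzy ▸ hT.a_pow)
  rw [Matrix.SpecialLinearGroup.coe_mul] at htxz htzy
  rw [Matrix.trace_mul_comm] at htzy
  clear hx2 hxz
  wlog htr : Matrix.trace (x * z : Matrix (Fin 2) (Fin 2) F) =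
      Matrix.trace (y * z : Matrix (Fin 2) (Fin 2) F)
    generalizing x
  · refine this (-x) (by rw [proj_neg, hx]) (by simpa using hx0) (by simpa using htxz) ?_
    have := (sq_eq_sq_iff_eq_or_eq_neg.1 (htxz.trans htzy.symm)).resolve_left htr
    simp [this]
  have hρx : f (rho (α * β)) = proj y := by
    rw [map_mul, rho_α, rho_β, ← mul_inv_rev, map_inv, ← hy]
    exact hinv y hy2
  have hρy : f (rho (β * γ)) = proj x := by
    rw [map_mul, rho_β, rho_γ, ← mul_inv_rev, map_inv, ← hx]
    exact hinv x (by simpa [hx] using hT.ab_sq)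
  have hρz : f (rho (α * β * γ)) = proj z := by
    rw [map_mul rho (α * β), map_mul rho α, rho_α, rho_β, rho_γ, ← mul_inv_rev, ← mul_inv_rev,
      ← mul_assoc, map_inv, ← hz]
    exact hinv z hz2
  set g : Matrix (Fin 2) (Fin 2) F := x - y with hgdef
  have hgen : ∀ w ∈ ({α * β, β * γ, α * β * γ} : Set Tet),
      ∃ s t : Matrix.SpecialLinearGroup (Fin 2) F,
        proj s = f w ∧ proj t = f (rho w) ∧ g * s = t * g := by
    have hxx := sq_eq_trace_smul_sub x
    have hyy := sq_eq_trace_smul_sub y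
    rw [hx0, zero_smul, zero_sub] at hxx
    rw [hy0, zero_smul, zero_sub] at hyy
    rintro w (rfl | rfl | rfl)
    · refine ⟨x, -y, hx, by rw [proj_neg, hρx], ?_⟩
      rw [Matrix.SpecialLinearGroup.coe_neg, hgdef, sub_mul, mul_sub, neg_mul, neg_mul, hxx, hyy]
      abel
    · refine ⟨y, -x, hy, by rw [proj_neg, hρy], ?_⟩
      rw [Matrix.SpecialLinearGroup.coe_neg, hgdef, sub_mul, mul_sub, neg_mul, neg_mul, hxx, hyy]
      abel
    · refine ⟨z, -z, hz, by rw [proj_neg, hρz], ?_⟩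
      have hxz := mul_add_mul_of_trace_eq_zero hx0 hz0
      have hyz := mul_add_mul_of_trace_eq_zero hy0 hz0
      rw [htr, ← hyz] at hxz
      rw [Matrix.SpecialLinearGroup.coe_neg, hgdef, sub_mul, mul_sub, neg_mul, neg_mul]
      rw [← sub_eq_zero] at hxz ⊢
      rw [← hxz]
      abel
  by_cases hg : g = 0
  · have hxy : f (α * β) = f (β * γ) := by
      rw [← hx, ← hy, show x = y from Subtype.ext (sub_eq_zero.1 hg)]
    have heq : MonoidHom.eqLocus (f.comp rho.toMonoidHom) f = ⊤ := by
      refine eq_top_of_involutions_mem ?_ ?_ ?_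
      · exact hρx.trans (hy.trans hxy.symm)
      · exact hρy.trans (hx.trans hxy)
      · exact hρz.trans hz
    have hmem : w ∈ MonoidHom.eqLocus (f.comp rho.toMonoidHom) f := heq ▸ Subgroup.mem_top w
    exact Eq.trans hmem hw
  · refine map_rho_eq_one_of_intertwiner (det_ne_zero_of_surjective hf hg ?_ ?_) hgen hw
    · rw [hgdef, Matrix.trace_sub, hx0, hy0, sub_zero]
    · intro w hw
      obtain ⟨s, t, hs, -, h⟩ := hgen w hw
      exact ⟨s, t, hs, h⟩

end PSL

end Tet

theorem stmt_7 :
    (∃! ρ : MulAut Tet, RhoSpec ρ) ∧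
    ∀ ρ : MulAut Tet, RhoSpec ρ →
      ρ * ρ = 1 ∧
      ∀ (F : Type) [Field F] [Finite F] (K : Subgroup Tet),
        IsPSLQuotient F K → K.map ρ.toMonoidHom = K := by
  refine ⟨⟨Tet.rho, Tet.rhoSpec_iff.2 rfl, fun ρ => Tet.rhoSpec_iff.1⟩, fun ρ hρ => ?_⟩
  obtain rfl := Tet.rhoSpec_iff.1 hρ
  refine ⟨MulEquiv.ext Tet.rho_rho, ?_⟩
  rintro F _ _ _ ⟨f, hf, rfl⟩
  exact Tet.map_rho_eq_of_le_comap fun w hw => Tet.map_rho_eq_one hf hw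
end

section
/- Let Δ be the tetrahedral group [3,5,3]⁺, let ρ be the automorphism of Δ with ρ(α) = γ⁻¹, ρ(β) = β⁻¹, ρ(γ) = α⁻¹, and let Ω⁺ be the semidirect product Δ ⋊ C₂, where the nontrivial element of the cyclic group C₂ of order 2 acts on Δ as ρ. For every prime power q and every normal subgroup K of Δ with Δ/K isomorphic to PSL(2, F_q), the image of K under the canonical embedding Δ → Ω⁺ is a normal subgroup of Ω⁺, and the quotient of Ω⁺ by this subgroup is isomorphic either to PGL(2, F_q) or to PSL(2, F_q) × C₂. -/
/-- `PGL(2, F)`: the quotient of `GL(2, F)` by its center. -/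
abbrev PGL2 (F : Type) [Field F] : Type :=
  Matrix.GeneralLinearGroup (Fin 2) F ⧸ Subgroup.center (Matrix.GeneralLinearGroup (Fin 2) F)

open Matrix

section TwoByTwo

variable {R : Type*} [CommRing R]

/-- The quadratic relation satisfied by the trace of a product of three `2 × 2` matrices. -/
theorem trace_mul_mul_fin_two_quadratic (A B C : Matrix (Fin 2) (Fin 2) R) :
    (A * B * C).trace ^ 2 - (A * B * C).trace *
      (A.trace * (B * C).trace + B.trace * (A * C).trace + C.trace * (A * B).trace
        - A.trace * B.trace * C.trace)
      + A.trace ^ 2 * B.det * C.det + B.trace ^ 2 * A.det * C.det + C.trace ^ 2 * A.det * B.det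
      + (A * B).trace ^ 2 * C.det + (B * C).trace ^ 2 * A.det + (A * C).trace ^ 2 * B.det
      - A.trace * B.trace * (A * B).trace * C.det - B.trace * C.trace * (B * C).trace * A.det
      - A.trace * C.trace * (A * C).trace * B.det
      + (A * B).trace * (B * C).trace * (A * C).trace - 4 * A.det * B.det * C.det = 0 := by
  simp only [trace_fin_two, det_fin_two, mul_apply, Fin.sum_univ_two]
  ring

theorem adjugate_fin_two_eq_neg_of_trace_eq_zero {M : Matrix (Fin 2) (Fin 2) R}
    (hM : M.trace = 0) : M.adjugate = -M := by
  rw [trace_fin_two] at hM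
  ext i j
  fin_cases i <;> fin_cases j <;> simp [adjugate_fin_two] <;> grind

theorem sub_mul_eq_adjugate_mul_sub {A C : Matrix (Fin 2) (Fin 2) R} (hA : A.det = 1)
    (hC : C.det = 1) (htA : A.trace = 1) (htC : C.trace = 1) :
    (A - C) * A = C.adjugate * (A - C) := by
  rw [trace_fin_two] at htA htC
  rw [det_fin_two] at hA hC
  ext i j
  fin_cases i <;> fin_cases j <;>
    simp [mul_apply, Fin.sum_univ_two, adjugate_fin_two] <;> grind

theorem mul_eq_adjugate_mul_of_trace_eq_zero {M B : Matrix (Fin 2) (Fin 2) R}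
    (hM : M.trace = 0) (hMB : (M * B).trace = 0) : M * B = B.adjugate * M := by
  have h := adjugate_fin_two_eq_neg_of_trace_eq_zero hMB
  rw [adjugate_mul_distrib, adjugate_fin_two_eq_neg_of_trace_eq_zero hM, mul_neg] at h
  exact (neg_injective h).symm

theorem det_sub_fin_two (A C : Matrix (Fin 2) (Fin 2) R) :
    (A - C).det = A.det + C.det + (A * C).trace - A.trace * C.trace := by
  simp only [trace_fin_two, det_fin_two, mul_apply, Fin.sum_univ_two, Matrix.sub_apply]
  ring

theorem mul_self_fin_two_of_trace_eq_zero {M : Matrix (Fin 2) (Fin 2) R} (hM : M.trace = 0) :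
    M * M = scalar (Fin 2) (-M.det) := by
  have h := mul_adjugate M
  rw [adjugate_fin_two_eq_neg_of_trace_eq_zero hM, mul_neg] at h
  rw [← neg_neg (M * M), h]
  simp [smul_one_eq_diagonal]

end TwoByTwo

theorem eq_one_of_coprime_pow {G : Type*} [Group G] {g : G} {k l : ℕ} (hkl : Nat.Coprime k l)
    (hk : g ^ k = 1) (hl : g ^ l = 1) : g = 1 := by
  rw [← orderOf_eq_one_iff, ← Nat.dvd_one, ← hkl.gcd_eq_one]
  exact Nat.dvd_gcd (orderOf_dvd_of_pow_eq_one hk) (orderOf_dvd_of_pow_eq_one hl)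

section ProjectiveLinear

variable {F : Type} [Field F]

local notation "SL₂" => Matrix.SpecialLinearGroup (Fin 2)

local notation "PSL₂" => Matrix.ProjectiveSpecialLinearGroup (Fin 2)

theorem mem_center_iff_fin_two (A : SL₂ F) :
    A ∈ Subgroup.center (SL₂ F) ↔ A 0 1 = 0 ∧ A 1 0 = 0 ∧ A 0 0 = A 1 1 := by
  rw [Matrix.SpecialLinearGroup.mem_center_iff]
  have hdet := A.det_coe
  rw [det_fin_two] at hdet
  constructor
  · rintro ⟨r, -, h⟩
    rw [← h]
    simp
  · rintro ⟨h1, h2, h3⟩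
    refine ⟨A 0 0, ?_, ?_⟩
    · simp only [Fintype.card_fin]
      grind
    · ext i j
      fin_cases i <;> fin_cases j <;> simp [h1, h2, h3]

theorem mk_eq_one_iff_fin_two (A : SL₂ F) :
    (QuotientGroup.mk A : PSL₂ F) = 1 ↔ A 0 1 = 0 ∧ A 1 0 = 0 ∧ A 0 0 = A 1 1 := by
  rw [QuotientGroup.eq_one_iff, mem_center_iff_fin_two]

theorem mk_sq_eq_one_iff (A : SL₂ F) :
    (QuotientGroup.mk A : PSL₂ F) ^ 2 = 1 ↔
      (QuotientGroup.mk A : PSL₂ F) = 1 ∨ (A : Matrix (Fin 2) (Fin 2) F).trace = 0 := by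
  rw [← QuotientGroup.mk_pow, mk_eq_one_iff_fin_two, mk_eq_one_iff_fin_two, trace_fin_two]
  simp only [pow_two, Matrix.SpecialLinearGroup.coe_mul, mul_apply, Fin.sum_univ_two]
  grind

theorem trace_sq_eq_one_of_mk_pow_three_eq_one {A : SL₂ F}
    (h : (QuotientGroup.mk A : PSL₂ F) ^ 3 = 1) (h1 : (QuotientGroup.mk A : PSL₂ F) ≠ 1) :
    (A : Matrix (Fin 2) (Fin 2) F).trace ^ 2 = 1 := by
  have hdet := A.det_coe
  rw [det_fin_two] at hdet
  rw [Ne, mk_eq_one_iff_fin_two] at h1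
  rw [← QuotientGroup.mk_pow, mk_eq_one_iff_fin_two] at h
  simp only [pow_succ, pow_zero, one_mul, Matrix.SpecialLinearGroup.coe_mul, mul_apply,
    Fin.sum_univ_two] at h
  rw [trace_fin_two]
  grind

/-- An element of order three of `PSL(2, F)` has a lift of trace `1`. -/
theorem exists_lift_trace_eq_one {a : PSL₂ F} (h : a ^ 3 = 1) (h1 : a ≠ 1) :
    ∃ A : SL₂ F, QuotientGroup.mk A = a ∧ (A : Matrix (Fin 2) (Fin 2) F).trace = 1 := by
  obtain ⟨A, rfl⟩ := QuotientGroup.mk_surjective a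
  rcases sq_eq_one_iff.mp (trace_sq_eq_one_of_mk_pow_three_eq_one h h1) with hA | hA
  · exact ⟨A, rfl, hA⟩
  · refine ⟨-A, ?_, ?_⟩
    · rw [QuotientGroup.eq, mem_center_iff_fin_two]
      simp
    · simp [hA]

instance : Nontrivial (PSL₂ F) := by
  let A : SL₂ F := ⟨!![1, 1; 0, 1], by simp⟩
  refine ⟨QuotientGroup.mk A, 1, ?_⟩
  rw [Ne, mk_eq_one_iff_fin_two]
  simp [A]

/-- The canonical homomorphism `PSL(2, F) → PGL(2, F)`. -/
def pslToPGL (F : Type) [Field F] : PSL₂ F →* PGL2 F :=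
  QuotientGroup.map _ _ Matrix.SpecialLinearGroup.toGL fun A hA =>
    Matrix.SpecialLinearGroup.toGL_mem_center_iff A |>.mpr hA

theorem pslToPGL_mk (A : SL₂ F) :
    pslToPGL F (QuotientGroup.mk A) = QuotientGroup.mk A.toGL := rfl

theorem pslToPGL_injective : Function.Injective (pslToPGL F) := by
  rw [injective_iff_map_eq_one]
  intro a
  induction a using QuotientGroup.induction_on with | H A
  rw [pslToPGL_mk, QuotientGroup.eq_one_iff, QuotientGroup.eq_one_iff,
    Matrix.SpecialLinearGroup.toGL_mem_center_iff]
  exact id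

theorem mk_mem_range_pslToPGL {g : GL (Fin 2) F}
    (hg : IsSquare (g : Matrix (Fin 2) (Fin 2) F).det) :
    (QuotientGroup.mk g : PGL2 F) ∈ (pslToPGL F).range := by
  obtain ⟨s, hs⟩ := hg
  have hdet := g.det_ne_zero
  have hs0 : s ≠ 0 := by
    rintro rfl
    simp [hs] at hdet
  let A : SL₂ F := ⟨s⁻¹ • (g : Matrix (Fin 2) (Fin 2) F), by
    rw [det_smul, hs, Fintype.card_fin]
    field_simp⟩
  refine ⟨QuotientGroup.mk A, ?_⟩
  rw [pslToPGL_mk, QuotientGroup.eq, GeneralLinearGroup.center_eq_range_scalar]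
  refine ⟨Units.mk0 s hs0, ?_⟩
  rw [eq_inv_mul_iff_mul_eq]
  ext i j
  simp only [Units.val_mul, GeneralLinearGroup.coe_scalar, Units.val_mk0, scalar_apply,
    mul_diagonal]
  change s⁻¹ * g i j * s = g i j
  field_simp

theorem isSquare_mul_of_not_isSquare [Finite F] {a b : F} (ha : ¬ IsSquare a)
    (hb : ¬ IsSquare b) : IsSquare (a * b) := by
  classical
  have := Fintype.ofFinite F
  by_contra h
  rw [← quadraticChar_neg_one_iff_not_isSquare] at ha hb h
  rw [map_mul, ha, hb] at h
  norm_num at h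

/-- Over a finite field, `PSL(2, F)` has index at most two in `PGL(2, F)`. -/
theorem mul_mem_range_pslToPGL [Finite F] {g m : PGL2 F} (hg : g ∉ (pslToPGL F).range)
    (hm : m ∉ (pslToPGL F).range) : g * m ∈ (pslToPGL F).range := by
  induction g using QuotientGroup.induction_on with | H g
  induction m using QuotientGroup.induction_on with | H m
  rw [← QuotientGroup.mk_mul]
  apply mk_mem_range_pslToPGL
  rw [Units.val_mul, det_mul]
  exact isSquare_mul_of_not_isSquare (fun h => hg (mk_mem_range_pslToPGL h))
    fun h => hm (mk_mem_range_pslToPGL h)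

theorem exists_conj_inv_of_trace {A B C : SL₂ F}
    (hA : (A : Matrix (Fin 2) (Fin 2) F).trace = 1)
    (hC : (C : Matrix (Fin 2) (Fin 2) F).trace = 1)
    (hB : (B : Matrix (Fin 2) (Fin 2) F).trace ≠ 0)
    (hAB : (A * B : Matrix (Fin 2) (Fin 2) F).trace = 0)
    (hBC : (B * C : Matrix (Fin 2) (Fin 2) F).trace = 0)
    (hABC : (A * B * C : Matrix (Fin 2) (Fin 2) F).trace = 0) :
    ∃ M : GL (Fin 2) F, M * M ∈ Subgroup.center (GL (Fin 2) F) ∧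
      M * A.toGL = C⁻¹.toGL * M ∧ M * B.toGL = B⁻¹.toGL * M ∧ M * C.toGL = A⁻¹.toGL * M := by
  have hdet : (A - C : Matrix (Fin 2) (Fin 2) F).det ≠ 0 := by
    have h := trace_mul_mul_fin_two_quadratic (A : Matrix (Fin 2) (Fin 2) F) B C
    rw [det_sub_fin_two]
    simp only [hA, hC, hAB, hBC, hABC, Matrix.SpecialLinearGroup.det_coe] at h ⊢
    grind
  have htr : (A - C : Matrix (Fin 2) (Fin 2) F).trace = 0 := by
    rw [trace_sub, hA, hC, sub_self]
  refine ⟨GeneralLinearGroup.mkOfDetNeZero _ hdet, ?_, ?_, ?_, ?_⟩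
  · rw [GeneralLinearGroup.center_eq_range_scalar]
    refine ⟨Units.mk0 _ (neg_ne_zero.mpr hdet), ?_⟩
    apply Units.ext
    exact (mul_self_fin_two_of_trace_eq_zero htr).symm
  · apply Units.ext
    exact sub_mul_eq_adjugate_mul_sub A.det_coe C.det_coe hA hC
  · apply Units.ext
    refine mul_eq_adjugate_mul_of_trace_eq_zero htr ?_
    change ((A - C : Matrix (Fin 2) (Fin 2) F) * (B : Matrix (Fin 2) (Fin 2) F)).trace = 0
    rw [sub_mul, trace_sub, hAB, trace_mul_comm, hBC, sub_self]
  · apply Units.ext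
    have h := sub_mul_eq_adjugate_mul_sub C.det_coe A.det_coe hC hA
    rw [← neg_sub, neg_mul, mul_neg, neg_inj] at h
    exact h

/-- A nontrivial triple in `PSL(2, F)` satisfying the relations of the tetrahedral group is
taken to the triple `(c⁻¹, b⁻¹, a⁻¹)` by conjugation with an involution of `PGL(2, F)`. -/
theorem exists_conj_inv_of_relations {a b c : PSL₂ F} (ha : a ^ 3 = 1) (hb : b ^ 5 = 1)
    (hc : c ^ 3 = 1) (hab : (a * b) ^ 2 = 1) (hbc : (b * c) ^ 2 = 1)
    (habc : (a * b * c) ^ 2 = 1) (hb1 : b ≠ 1) :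
    ∃ m : PGL2 F, m * m = 1 ∧ m * pslToPGL F a = pslToPGL F c⁻¹ * m ∧
      m * pslToPGL F b = pslToPGL F b⁻¹ * m ∧ m * pslToPGL F c = pslToPGL F a⁻¹ * m := by
  have ha1 : a ≠ 1 := by
    rintro rfl
    exact hb1 (eq_one_of_coprime_pow (l := 2) (by norm_num) hb (by simpa using hab))
  have hc1 : c ≠ 1 := by
    rintro rfl
    exact hb1 (eq_one_of_coprime_pow (l := 2) (by norm_num) hb (by simpa using hbc))
  have hab1 : a * b ≠ 1 := fun h => by
    rw [eq_inv_of_mul_eq_one_left h, inv_pow, inv_eq_one] at ha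
    exact hb1 (eq_one_of_coprime_pow (by norm_num) hb ha)
  have hbc1 : b * c ≠ 1 := fun h => by
    rw [eq_inv_of_mul_eq_one_right h, inv_pow, inv_eq_one] at hc
    exact hb1 (eq_one_of_coprime_pow (by norm_num) hb hc)
  have habc1 : a * b * c ≠ 1 := fun h => by
    rw [eq_inv_of_mul_eq_one_left h, inv_pow, inv_eq_one] at hab
    exact hc1 (eq_one_of_coprime_pow (by norm_num) hc hab)
  obtain ⟨A, rfl, hA⟩ := exists_lift_trace_eq_one ha ha1
  obtain ⟨C, rfl, hC⟩ := exists_lift_trace_eq_one hc hc1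
  obtain ⟨B, rfl⟩ := QuotientGroup.mk_surjective b
  have hB : (B : Matrix (Fin 2) (Fin 2) F).trace ≠ 0 := fun h =>
    hb1 (eq_one_of_coprime_pow (by norm_num) hb ((mk_sq_eq_one_iff B).mpr (.inr h)))
  obtain ⟨M, hM, h1, h2, h3⟩ := exists_conj_inv_of_trace hA hC hB
    (((mk_sq_eq_one_iff (A * B)).mp hab).resolve_left hab1)
    (((mk_sq_eq_one_iff (B * C)).mp hbc).resolve_left hbc1)
    (((mk_sq_eq_one_iff (A * B * C)).mp habc).resolve_left habc1)
  refine ⟨QuotientGroup.mk M, (QuotientGroup.eq_one_iff _).mpr hM, ?_, ?_, ?_⟩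
  · exact congrArg QuotientGroup.mk h1
  · exact congrArg QuotientGroup.mk h2
  · exact congrArg QuotientGroup.mk h3

end ProjectiveLinear

section SemidirectProduct

variable {N Q : Type*} [Group N] [Group Q] {φ : Multiplicative (ZMod 2) →* MulAut N}

theorem multiplicative_zmod_two_cases (w : Multiplicative (ZMod 2)) :
    w = 1 ∨ w = Multiplicative.ofAdd 1 := by
  revert w
  decide

theorem semidirectProduct_cases (z : N ⋊[φ] Multiplicative (ZMod 2)) :
    ∃ x : N, z = SemidirectProduct.inl x ∨
      z = SemidirectProduct.inl x * SemidirectProduct.inr (Multiplicative.ofAdd 1) := by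
  refine ⟨z.left, ?_⟩
  have hz := SemidirectProduct.inl_left_mul_inr_right z
  rcases multiplicative_zmod_two_cases z.right with h | h <;> rw [h] at hz
  · rw [map_one, mul_one] at hz
    exact .inl hz.symm
  · exact .inr hz.symm

/-- A homomorphism from `N` extends to `N ⋊ C₂` once the action of the generator of `C₂` is
realised by conjugation with an involution. -/
theorem exists_semidirectProduct_lift (g : N →* Q) (m : Q) (hm : m * m = 1)
    (h : ∀ x, g (φ (Multiplicative.ofAdd 1) x) = m * g x * m⁻¹) :
    ∃ G : N ⋊[φ] Multiplicative (ZMod 2) →* Q,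
      (∀ x, G (SemidirectProduct.inl x) = g x) ∧
        G (SemidirectProduct.inr (Multiplicative.ofAdd 1)) = m := by
  let ψ : Multiplicative (ZMod 2) →* Q :=
    { toFun := fun w => if w = 1 then 1 else m
      map_one' := if_pos rfl
      map_mul' := fun v w => by
        rcases multiplicative_zmod_two_cases v with rfl | rfl <;>
          rcases multiplicative_zmod_two_cases w with rfl | rfl
        · simp
        · simp
        · simp
        · rw [if_pos (by decide), if_neg (by decide), hm] }
  have hψ : ψ (Multiplicative.ofAdd 1) = m := by
    change (if (Multiplicative.ofAdd 1 : Multiplicative (ZMod 2)) = 1 then 1 else m) = m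
    exact if_neg (by decide)
  refine ⟨SemidirectProduct.lift g ψ fun w => ?_, fun x => ?_, ?_⟩
  · ext x
    rcases multiplicative_zmod_two_cases w with rfl | rfl
    · simp
    · simp [hψ, h]
  · rw [SemidirectProduct.lift_inl]
  · rw [SemidirectProduct.lift_inr, hψ]

end SemidirectProduct

theorem stmt_8 (ρ : MulAut Tet)
    (hρ0 : ρ (PresentedGroup.of 0) = (PresentedGroup.of 2)⁻¹)
    (hρ1 : ρ (PresentedGroup.of 1) = (PresentedGroup.of 1)⁻¹)
    (hρ2 : ρ (PresentedGroup.of 2) = (PresentedGroup.of 0)⁻¹)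
    (φ : Multiplicative (ZMod 2) →* MulAut Tet)
    (hφ : φ (Multiplicative.ofAdd 1) = ρ)
    (F : Type) [Field F] [Finite F]
    (K : Subgroup Tet) (hK : IsPSLQuotient F K) :
    (K.map (SemidirectProduct.inl : Tet →* Tet ⋊[φ] Multiplicative (ZMod 2))).Normal ∧
    ((∃ f : (Tet ⋊[φ] Multiplicative (ZMod 2)) →* PGL2 F,
        Function.Surjective f ∧
        f.ker = K.map (SemidirectProduct.inl : Tet →* Tet ⋊[φ] Multiplicative (ZMod 2))) ∨
     (∃ f : (Tet ⋊[φ] Multiplicative (ZMod 2)) →*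
         Matrix.ProjectiveSpecialLinearGroup (Fin 2) F × Multiplicative (ZMod 2),
        Function.Surjective f ∧
        f.ker = K.map (SemidirectProduct.inl : Tet →* Tet ⋊[φ] Multiplicative (ZMod 2)))) := by
  obtain ⟨f, hf, rfl⟩ := hK
  have rel {r : FreeGroup (Fin 3)} (hr : r ∈ tetRelators) :
      f (PresentedGroup.mk tetRelators r) = 1 := by
    rw [PresentedGroup.one_of_mem hr, map_one]
  have ha : f (PresentedGroup.of 0) ^ 3 = 1 := by
    rw [← map_pow]
    exact rel (r := FreeGroup.of 0 ^ 3) (by simp [tetRelators])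
  have hb : f (PresentedGroup.of 1) ^ 5 = 1 := by
    rw [← map_pow]
    exact rel (r := FreeGroup.of 1 ^ 5) (by simp [tetRelators])
  have hc : f (PresentedGroup.of 2) ^ 3 = 1 := by
    rw [← map_pow]
    exact rel (r := FreeGroup.of 2 ^ 3) (by simp [tetRelators])
  have hab : (f (PresentedGroup.of 0) * f (PresentedGroup.of 1)) ^ 2 = 1 := by
    rw [← map_mul, ← map_pow]
    exact rel (r := (FreeGroup.of 0 * FreeGroup.of 1) ^ 2) (by simp [tetRelators])
  have hbc : (f (PresentedGroup.of 1) * f (PresentedGroup.of 2)) ^ 2 = 1 := by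
    rw [← map_mul, ← map_pow]
    exact rel (r := (FreeGroup.of 1 * FreeGroup.of 2) ^ 2) (by simp [tetRelators])
  have habc : (f (PresentedGroup.of 0) * f (PresentedGroup.of 1) * f (PresentedGroup.of 2)) ^ 2 =
      1 := by
    rw [← map_mul, ← map_mul, ← map_pow]
    exact rel (r := (FreeGroup.of 0 * FreeGroup.of 1 * FreeGroup.of 2) ^ 2)
      (by simp [tetRelators])
  have hb1 : f (PresentedGroup.of 1) ≠ 1 := by
    intro h
    rw [h, mul_one] at hab
    rw [h, one_mul] at hbc
    have hf1 : f = 1 := by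
      refine PresentedGroup.ext fun i => ?_
      fin_cases i
      · exact eq_one_of_coprime_pow (by norm_num) ha hab
      · exact h
      · exact eq_one_of_coprime_pow (by norm_num) hc hbc
    obtain ⟨p, hp⟩ := exists_ne (1 : Matrix.ProjectiveSpecialLinearGroup (Fin 2) F)
    obtain ⟨x, rfl⟩ := hf p
    exact hp (by rw [hf1, MonoidHom.one_apply])
  obtain ⟨m, hm, hm0, hm1, hm2⟩ := exists_conj_inv_of_relations ha hb hc hab hbc habc hb1
  have hconj : ((pslToPGL F).comp f).comp ρ.toMonoidHom =
      (MulAut.conj m).toMonoidHom.comp ((pslToPGL F).comp f) := by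
    refine PresentedGroup.ext fun i => ?_
    fin_cases i
    · simp [hρ0, hm0]
    · simp [hρ1, hm1]
    · simp [hρ2, hm2]
  have hρ (x : Tet) : pslToPGL F (f (φ (Multiplicative.ofAdd 1) x)) =
      m * pslToPGL F (f x) * m⁻¹ := by
    rw [hφ]
    exact DFunLike.congr_fun hconj x
  suffices h : _ ∨ _ by
    refine ⟨?_, h⟩
    rcases h with ⟨g, -, hg⟩ | ⟨g, -, hg⟩ <;> exact hg ▸ g.normal_ker
  by_cases hmr : m ∈ (pslToPGL F).range
  · right
    obtain ⟨n, rfl⟩ := hmr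
    obtain ⟨G, hG, hGn⟩ := exists_semidirectProduct_lift (φ := φ) f n
      (pslToPGL_injective (by rw [map_mul, hm, map_one]))
      fun x => pslToPGL_injective (by rw [hρ, map_mul, map_mul, map_inv])
    refine ⟨G.prod SemidirectProduct.rightHom, fun ⟨p, w⟩ => ?_, ?_⟩
    · rcases multiplicative_zmod_two_cases w with rfl | rfl
      · obtain ⟨x, rfl⟩ := hf p
        exact ⟨SemidirectProduct.inl x, by simp [hG]⟩
      · obtain ⟨x, hx⟩ := hf (p * n⁻¹)
        exact ⟨SemidirectProduct.inl x * SemidirectProduct.inr (Multiplicative.ofAdd 1),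
          by simp [hG, hGn, hx]⟩
    · ext z
      obtain ⟨x, rfl | rfl⟩ := semidirectProduct_cases z
      · rw [Subgroup.mem_map_iff_mem SemidirectProduct.inl_injective]
        simp [MonoidHom.mem_ker, hG]
      · refine iff_of_false (fun h => ?_) ?_
        · simpa using congrArg Prod.snd (MonoidHom.mem_ker.mp h)
        · rintro ⟨y, -, hy⟩
          simpa using (congrArg SemidirectProduct.rightHom hy).symm
  · left
    obtain ⟨G, hG, hGm⟩ := exists_semidirectProduct_lift (φ := φ) ((pslToPGL F).comp f) m hm hρ
    refine ⟨G, fun p => ?_, ?_⟩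
    · by_cases hp : p ∈ (pslToPGL F).range
      · obtain ⟨a, rfl⟩ := hp
        obtain ⟨x, rfl⟩ := hf a
        exact ⟨SemidirectProduct.inl x, hG x⟩
      · obtain ⟨a, ha⟩ := mul_mem_range_pslToPGL hp hmr
        obtain ⟨x, rfl⟩ := hf a
        refine ⟨SemidirectProduct.inl x * SemidirectProduct.inr (Multiplicative.ofAdd 1), ?_⟩
        rw [map_mul, hG, hGm, MonoidHom.comp_apply, ha, mul_assoc, hm, mul_one]
    · ext z
      obtain ⟨x, rfl | rfl⟩ := semidirectProduct_cases z
      · rw [Subgroup.mem_map_iff_mem SemidirectProduct.inl_injective, MonoidHom.mem_ker, hG,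
          MonoidHom.comp_apply, map_eq_one_iff _ pslToPGL_injective, MonoidHom.mem_ker]
      · refine iff_of_false (fun h => hmr ?_) ?_
        · rw [MonoidHom.mem_ker, map_mul, hG, hGm] at h
          rw [eq_inv_of_mul_eq_one_right h]
          exact inv_mem ⟨f x, rfl⟩
        · rintro ⟨y, -, hy⟩
          simpa using (congrArg SemidirectProduct.rightHom hy).symm
end
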